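/- arXiv:1509.09210 — 3 statements merged into one kernel-verified Lean document; each statement's English description precedes it below -/
import Mathlib

section
/- If T is a PTE-tree and T' is any tree such that U(T) = U(T'), then T' is isomorphic to T. In other words, PTE-trees are distinguished up to isomorphism among all trees by the U-polynomial. -/
open scoped Classical

/-- The multiset of sizes of the connected components of a finite graph. -/
noncomputable def componentSizes {V : Type} [Fintype V] (H : SimpleGraph V) : Multiset ℕ :=
  (Finset.univ : Finset H.ConnectedComponent).val.map fun c => Nat.card c.supp

/-- The `U_k`-polynomial of a graph, encoded as the multiset of partitions
`λ(E \ A)` over all edge subsets `A` with `|A| ≤ k`.  Two graphs have the same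
`U_k`-polynomial iff these multisets coincide. -/
noncomputable def UkPoly {V : Type} [Fintype V] (G : SimpleGraph V) (k : ℕ) :
    Multiset (Multiset ℕ) :=
  (G.edgeFinset.powerset.filter fun A => A.card ≤ k).val.map fun A =>
    componentSizes (G.deleteEdges ↑A)

/-- The `U`-polynomial of a graph, encoded as the multiset of partitions
`λ(E \ A)` over all edge subsets `A`. -/
noncomputable def UPoly {V : Type} [Fintype V] (G : SimpleGraph V) :
    Multiset (Multiset ℕ) :=
  G.edgeFinset.powerset.val.map fun A => componentSizes (G.deleteEdges ↑A)

/-- Vertex type for the tree `T(p,s)`: a central vertex, roots `v_1,…,v_n`, and for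
each `i` the extra vertices of `p i` copies of a 4-vertex path and `s i` copies of
a 4-vertex star (3 extra vertices each, the remaining leaf being identified with
the root `v_i`). -/
abbrev Vtx (n : ℕ) (p s : Fin n → ℕ) : Type :=
  Unit ⊕ Fin n ⊕ ((Σ i : Fin n, Fin (p i) × Fin 3) ⊕ (Σ i : Fin n, Fin (s i) × Fin 3))

/-- Edges of `T(p,s)`: the central vertex is joined to each root `v_i`; each copy of
a 4-vertex path hangs from `v_i` as `v_i — x₀ — x₁ — x₂`; each copy of a 4-vertex
star hangs from `v_i` as `v_i — y₀` with extra leaves `y₁, y₂` adjacent to `y₀`. -/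
inductive TRel (n : ℕ) (p s : Fin n → ℕ) : Vtx n p s → Vtx n p s → Prop where
  | core (i : Fin n) :
      TRel n p s (Sum.inl ()) (Sum.inr (Sum.inl i))
  | pathRoot (i : Fin n) (j : Fin (p i)) :
      TRel n p s (Sum.inr (Sum.inl i)) (Sum.inr (Sum.inr (Sum.inl ⟨i, j, 0⟩)))
  | pathEdge (i : Fin n) (j : Fin (p i)) (l : Fin 2) :
      TRel n p s (Sum.inr (Sum.inr (Sum.inl ⟨i, j, l.castSucc⟩)))
        (Sum.inr (Sum.inr (Sum.inl ⟨i, j, l.succ⟩)))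
  | starRoot (i : Fin n) (j : Fin (s i)) :
      TRel n p s (Sum.inr (Sum.inl i)) (Sum.inr (Sum.inr (Sum.inr ⟨i, j, 0⟩)))
  | starEdge (i : Fin n) (j : Fin (s i)) (l : Fin 2) :
      TRel n p s (Sum.inr (Sum.inr (Sum.inr ⟨i, j, 0⟩)))
        (Sum.inr (Sum.inr (Sum.inr ⟨i, j, l.succ⟩)))

/-- The tree `T(p,s)`. -/
def TpsGraph (n : ℕ) (p s : Fin n → ℕ) : SimpleGraph (Vtx n p s) :=
  SimpleGraph.fromRel (TRel n p s)

/-- The PTE-tree `T_α(p) = T(p, α - p)`. -/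
def Ttree (α : ℕ) {n : ℕ} (p : Fin n → ℕ) : SimpleGraph (Vtx n p (fun i => α - p i)) :=
  TpsGraph n p (fun i => α - p i)

/-- `p` is an `α`-compatible sequence: it has length `n ≥ 2` and all entries `≤ α`. -/
def AlphaCompatible (α : ℕ) {n : ℕ} (p : Fin n → ℕ) : Prop :=
  2 ≤ n ∧ ∀ i, p i ≤ α

/-- A graph is a PTE-tree if it is isomorphic to some `T_α(p)` with `α` a positive
integer and `p` an `α`-compatible sequence. -/
def IsPTETree {V : Type} [Fintype V] (G : SimpleGraph V) : Prop :=
  ∃ (n α : ℕ) (p : Fin n → ℕ), 0 < α ∧ AlphaCompatible α p ∧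
    Nonempty (G ≃g Ttree α p)

theorem UPoly_eq_map {V : Type} [Fintype V] (G : SimpleGraph V) :
    UPoly G = G.edgeFinset.powerset.val.map fun A : Finset (Sym2 V) =>
      componentSizes (G.deleteEdges (A : Set (Sym2 V))) := by
  simp [UPoly, Multiset.bind_def, Multiset.pure_def, Multiset.bind_singleton]

/-- A rooted tree on `V`, given by its parent and depth functions. -/
structure ParentTree (V : Type) where
  root : V
  par : V → V
  depth : V → ℕ
  par_root : par root = root
  depth_root : depth root = 0
  depth_eq : ∀ v, v ≠ root → depth v = depth (par v) + 1

namespace ParentTree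

variable {V : Type} (R : ParentTree V)

/-- `R` is a rooting of the graph `G`: the edges of `G` join vertices to their parents. -/
def IsRootingOf (G : SimpleGraph V) : Prop :=
  ∀ u v, G.Adj u v ↔ (u ≠ R.root ∧ R.par u = v) ∨ (v ≠ R.root ∧ R.par v = u)

theorem induction {P : V → Prop} (root : P R.root)
    (step : ∀ v, v ≠ R.root → P (R.par v) → P v) (v : V) : P v := by
  obtain ⟨k, hk⟩ : ∃ k, R.depth v = k := ⟨_, rfl⟩
  induction k generalizing v with
  | zero =>
    by_cases hv : v = R.root
    · exact hv ▸ root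
    · have := R.depth_eq v hv
      omega
  | succ k ih =>
    by_cases hv : v = R.root
    · exact hv ▸ root
    · have := R.depth_eq v hv
      exact step v hv (ih _ (by omega))

/-- `w` is a descendant of `v` (possibly `v` itself). -/
def Desc (v w : V) : Prop := ∃ k, R.par^[k] w = v

theorem Desc.refl (v : V) : R.Desc v v := ⟨0, rfl⟩

variable {R} in
theorem Desc.trans {u v w : V} : R.Desc u v → R.Desc v w → R.Desc u w := by
  rintro ⟨k, rfl⟩ ⟨l, rfl⟩
  exact ⟨k + l, Function.iterate_add_apply _ _ _ _⟩

variable {R} in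
theorem Desc.of_par {v w : V} (h : R.Desc v (R.par w)) : R.Desc v w := by
  obtain ⟨k, rfl⟩ := h
  exact ⟨k + 1, rfl⟩

variable {R} in
theorem Desc.eq_or_par {v w : V} (h : R.Desc v w) : w = v ∨ R.Desc v (R.par w) := by
  obtain ⟨k, rfl⟩ := h
  cases k with
  | zero => exact Or.inl rfl
  | succ k => exact Or.inr ⟨k, rfl⟩

theorem par_iterate_root (k : ℕ) : R.par^[k] R.root = R.root := by
  induction k with
  | zero => rfl
  | succ k ih => rw [Function.iterate_succ_apply, R.par_root, ih]

theorem desc_root_right {v : V} (h : R.Desc v R.root) : v = R.root := by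
  obtain ⟨k, rfl⟩ := h
  exact R.par_iterate_root k

theorem desc_root_left (w : V) : R.Desc R.root w :=
  R.induction (P := R.Desc R.root) (Desc.refl R _) (fun _ _ h => h.of_par) w

variable {R} in
theorem Desc.depth_le {v w : V} (h : R.Desc v w) : R.depth v ≤ R.depth w ∧
    (R.depth v = R.depth w → v = w) := by
  revert h
  refine R.induction (P := fun w => R.Desc v w → R.depth v ≤ R.depth w ∧
    (R.depth v = R.depth w → v = w)) ?_ ?_ w
  · intro h
    rw [R.desc_root_right h]
    simp
  · intro w hw ih h
    have := R.depth_eq w hw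
    rcases h.eq_or_par with rfl | h
    · simp
    · have := (ih h).1
      exact ⟨by omega, fun h => by omega⟩

variable {R} in
theorem Desc.total {u v w : V} (hu : R.Desc u w) (hv : R.Desc v w) :
    R.Desc u v ∨ R.Desc v u := by
  obtain ⟨k, rfl⟩ := hu
  obtain ⟨l, rfl⟩ := hv
  rcases le_total k l with h | h
  · right
    exact ⟨l - k, by rw [← Function.iterate_add_apply, Nat.sub_add_cancel h]⟩
  · left
    exact ⟨k - l, by rw [← Function.iterate_add_apply, Nat.sub_add_cancel h]⟩

theorem edge_injOn {u v : V} (hu : u ≠ R.root) (hv : v ≠ R.root)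
    (h : s(u, R.par u) = s(v, R.par v)) : u = v := by
  rcases Sym2.eq_iff.1 h with ⟨h, -⟩ | ⟨h1, h2⟩
  · exact h
  · have h3 := R.depth_eq u hu
    have h4 := R.depth_eq v hv
    rw [h2] at h3
    rw [← h1] at h4
    omega

variable {R} in
theorem IsRootingOf.adj_par {G : SimpleGraph V} (hR : R.IsRootingOf G) {v : V} (hv : v ≠ R.root) :
    G.Adj v (R.par v) := (hR _ _).2 (Or.inl ⟨hv, rfl⟩)

section top

variable [DecidableEq V] (S : Finset V)

/-- The first vertex of `S` met on the way from `v` to the root. -/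
def top (v : V) : V := (fun x => if x ∈ S then x else R.par x)^[R.depth v] v

variable {S}

theorem top_of_mem {v : V} (hv : v ∈ S) : R.top S v = v :=
  Function.iterate_fixed (by simp [hv]) _

theorem top_of_notMem (hS : R.root ∈ S) {v : V} (hv : v ∉ S) :
    R.top S v = R.top S (R.par v) := by
  have : v ≠ R.root := fun h => hv (h ▸ hS)
  rw [top, R.depth_eq v this, Function.iterate_succ_apply, if_neg hv, top]

theorem top_mem (hS : R.root ∈ S) (v : V) : R.top S v ∈ S := by
  refine R.induction (P := fun v => R.top S v ∈ S) ?_ ?_ v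
  · rwa [R.top_of_mem hS]
  · intro v _ ih
    by_cases h : v ∈ S
    · rwa [R.top_of_mem h]
    · rwa [R.top_of_notMem hS h]

theorem desc_top (hS : R.root ∈ S) (v : V) : R.Desc (R.top S v) v := by
  refine R.induction (P := fun v => R.Desc (R.top S v) v) ?_ ?_ v
  · rw [R.top_of_mem hS]
    exact Desc.refl R _
  · intro v _ ih
    by_cases h : v ∈ S
    · rw [R.top_of_mem h]
      exact Desc.refl R _
    · rw [R.top_of_notMem hS h]
      exact ih.of_par

variable [Fintype V] (S)

/-- The sizes of the pieces obtained by cutting, for each `v ∈ S`, the edge above `v`. -/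
def sizes : Multiset ℕ :=
  S.val.map fun a => (Finset.univ.filter fun v => R.top S v = a).card

variable {S}

theorem card_sizes : (R.sizes S).card = S.card := by simp [sizes]

theorem sum_sizes (hS : R.root ∈ S) : (R.sizes S).sum = Fintype.card V :=
  (Finset.card_eq_sum_card_fiberwise (s := Finset.univ) (t := S) (f := R.top S)
    fun v _ => R.top_mem hS v).symm

end top

section graph

variable {R} [DecidableEq V]

/-- The edges cut above the vertices of `S`. -/
def cutEdges (R : ParentTree V) (S : Finset V) : Finset (Sym2 V) :=
  (S.erase R.root).image fun v => s(v, R.par v)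

theorem mem_cutEdges {S : Finset V} {v : V} (hv : v ≠ R.root) :
    s(v, R.par v) ∈ R.cutEdges S ↔ v ∈ S := by
  simp only [cutEdges, Finset.mem_image, Finset.mem_erase]
  constructor
  · rintro ⟨w, ⟨hw, hwS⟩, h⟩
    exact R.edge_injOn hw hv h ▸ hwS
  · exact fun h => ⟨v, ⟨hv, h⟩, rfl⟩

variable {G : SimpleGraph V}

theorem IsRootingOf.reachable_iff (hR : R.IsRootingOf G) {S : Finset V} (hS : R.root ∈ S)
    (u v : V) : (G.deleteEdges (R.cutEdges S : Set (Sym2 V))).Reachable u v ↔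
      R.top S u = R.top S v := by
  have key : ∀ w, (G.deleteEdges (R.cutEdges S : Set (Sym2 V))).Reachable w (R.top S w) := by
    intro w
    refine R.induction (P := fun w => (G.deleteEdges (R.cutEdges S : Set (Sym2 V))).Reachable w
      (R.top S w)) ?_ ?_ w
    · rw [R.top_of_mem hS]
    · intro w hw ih
      by_cases h : w ∈ S
      · rw [R.top_of_mem h]
      · rw [R.top_of_notMem hS h]
        refine SimpleGraph.Reachable.trans (SimpleGraph.Adj.reachable ?_) ih
        rw [SimpleGraph.deleteEdges_adj]
        exact ⟨hR.adj_par hw, fun h' => h ((mem_cutEdges hw).1 (Finset.mem_coe.1 h'))⟩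
  constructor
  · rintro ⟨p⟩
    induction p with
    | nil => rfl
    | cons hadj _ ih =>
      rw [← ih]
      rw [SimpleGraph.deleteEdges_adj, Finset.mem_coe] at hadj
      obtain ⟨hadj, hcut⟩ := hadj
      rcases (hR _ _).1 hadj with ⟨hr, rfl⟩ | ⟨hr, rfl⟩
      · exact R.top_of_notMem hS fun h => hcut ((mem_cutEdges hr).2 h)
      · rw [Sym2.eq_swap] at hcut
        exact (R.top_of_notMem hS fun h => hcut ((mem_cutEdges hr).2 h)).symm
  · intro h
    exact (key u).trans (h ▸ (key v).symm)

variable [Fintype V]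

theorem IsRootingOf.componentSizes_eq (hR : R.IsRootingOf G) {S : Finset V} (hS : R.root ∈ S) :
    componentSizes (G.deleteEdges (R.cutEdges S : Set (Sym2 V))) = R.sizes S := by
  symm
  refine Multiset.map_eq_map_of_bij_of_nodup _ _ S.nodup (Finset.nodup _)
    (fun a _ => SimpleGraph.connectedComponentMk _ a) (fun _ _ => by simp) ?_ ?_ ?_
  · intro a ha b hb h
    have := (hR.reachable_iff hS a b).1 (SimpleGraph.ConnectedComponent.exact h)
    rwa [R.top_of_mem ha, R.top_of_mem hb] at this
  · intro C _
    induction C using SimpleGraph.ConnectedComponent.ind with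
    | h v =>
      refine ⟨R.top S v, R.top_mem hS v, SimpleGraph.ConnectedComponent.sound ?_⟩
      rw [hR.reachable_iff hS, R.top_of_mem (R.top_mem hS v)]
  · intro a ha
    rw [Nat.card_eq_fintype_card, ← Set.toFinset_card]
    congr 1
    ext v
    have : R.top S v = a ↔ R.top S v = R.top S a := by rw [R.top_of_mem (S := S) ha]
    simp [hR.reachable_iff hS, this]

theorem IsRootingOf.UPoly_eq (hR : R.IsRootingOf G) :
    UPoly G = (Finset.univ.filter fun S : Finset V => R.root ∈ S).val.map fun S => R.sizes S := by
  rw [UPoly_eq_map]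
  symm
  refine Multiset.map_eq_map_of_bij_of_nodup _ _ (Finset.nodup _) (Finset.nodup _)
    (fun S _ => R.cutEdges S) ?_ ?_ ?_ ?_
  · intro S _
    simp only [Finset.mem_val, Finset.mem_powerset]
    intro e he
    simp only [cutEdges, Finset.mem_image, Finset.mem_erase] at he
    obtain ⟨v, ⟨hv, -⟩, rfl⟩ := he
    simpa using hR.adj_par hv
  · intro S hS S' hS' h
    simp only [Finset.mem_val, Finset.mem_filter, Finset.mem_univ, true_and] at hS hS'
    ext v
    by_cases hv : v = R.root
    · simp [hv, hS, hS']
    · rw [← mem_cutEdges hv, ← mem_cutEdges hv, h]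
  · intro E hE
    simp only [Finset.mem_val, Finset.mem_powerset] at hE
    refine ⟨Finset.univ.filter fun v => v = R.root ∨ s(v, R.par v) ∈ E, by simp, ?_⟩
    ext e
    constructor
    · intro he
      simp only [cutEdges, Finset.mem_image, Finset.mem_erase, Finset.mem_filter] at he
      obtain ⟨v, ⟨hv, -, hv'⟩, rfl⟩ := he
      exact hv'.resolve_left hv
    · intro he
      have hadj := hE he
      induction e using Sym2.ind with
      | h u v =>
        rw [SimpleGraph.mem_edgeFinset, SimpleGraph.mem_edgeSet] at hadj
        rcases (hR _ _).1 hadj with ⟨hr, rfl⟩ | ⟨hr, rfl⟩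
        · rw [mem_cutEdges hr]
          simp [he]
        · rw [Sym2.eq_swap] at he ⊢
          rw [mem_cutEdges hr]
          simp [he]
  · intro S hS
    simp only [Finset.mem_val, Finset.mem_filter, Finset.mem_univ, true_and] at hS
    rw [hR.componentSizes_eq hS]

theorem IsRootingOf.count_UPoly (hR : R.IsRootingOf G) (l : Multiset ℕ) :
    (UPoly G).count l = (Finset.univ.filter fun S => R.root ∈ S ∧ R.sizes S = l).card := by
  rw [hR.UPoly_eq, Multiset.count_map, ← Finset.filter_val, Finset.card_val, Finset.filter_filter]
  simp only [eq_comm]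

end graph

end ParentTree

theorem componentSizes_congr {V W : Type} [Fintype V] [Fintype W] {G : SimpleGraph V}
    {H : SimpleGraph W} (f : G ≃g H) : componentSizes G = componentSizes H := by
  refine Multiset.map_eq_map_of_bij_of_nodup _ _ (Finset.nodup _) (Finset.nodup _)
    (fun C _ => f.connectedComponentEquiv C) (fun _ _ => by simp)
    (fun _ _ _ _ h => f.connectedComponentEquiv.injective h) ?_ ?_
  · intro C _
    exact ⟨f.connectedComponentEquiv.symm C, by simp, by simp⟩
  · intro C _
    refine Nat.card_congr (f.toEquiv.subtypeEquiv fun v => ?_)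
    induction C using SimpleGraph.ConnectedComponent.ind with
    | h u => simp [SimpleGraph.Iso.reachable_iff]

theorem UPoly_congr {V W : Type} [Fintype V] [Fintype W] {G : SimpleGraph V}
    {H : SimpleGraph W} (f : G ≃g H) : UPoly G = UPoly H := by
  rw [UPoly_eq_map, UPoly_eq_map]
  have hinj : Function.Injective (Sym2.map f) := Sym2.map.injective f.injective
  have hmap : ∀ e, Sym2.map f e ∈ H.edgeSet ↔ e ∈ G.edgeSet := by
    intro e
    induction e using Sym2.ind with
    | h u v => simp [f.map_adj_iff]
  refine Multiset.map_eq_map_of_bij_of_nodup _ _ (Finset.nodup _) (Finset.nodup _)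
    (fun A _ => A.image (Sym2.map f)) ?_ ?_ ?_ ?_
  · intro A hA
    simp only [Finset.mem_val, Finset.mem_powerset] at hA ⊢
    intro e he
    obtain ⟨e, he', rfl⟩ := Finset.mem_image.1 he
    simpa [hmap] using hA he'
  · exact fun A _ B _ h => Finset.image_injective hinj h
  · intro A hA
    simp only [Finset.mem_val, Finset.mem_powerset] at hA
    have hsymm : ∀ e, Sym2.map f (Sym2.map f.symm e) = e := by
      intro e
      induction e using Sym2.ind with
      | h u v => simp
    refine ⟨A.image (Sym2.map f.symm), ?_, ?_⟩
    · simp only [Finset.mem_val, Finset.mem_powerset]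
      intro e he
      obtain ⟨e, he', rfl⟩ := Finset.mem_image.1 he
      rw [SimpleGraph.mem_edgeFinset, ← hmap, hsymm]
      simpa using hA he'
    · rw [Finset.image_image]
      rw [show Sym2.map f ∘ Sym2.map f.symm = id from funext hsymm, Finset.image_id]
  · intro A _
    refine componentSizes_congr ⟨f.toEquiv, ?_⟩
    intro u v
    have : s(f u, f v) ∈ A.image (Sym2.map f) ↔ s(u, v) ∈ A := by
      rw [← Sym2.map_mk, hinj.mem_finset_image]
    simp only [SimpleGraph.deleteEdges_adj, Finset.mem_coe, RelIso.coe_fn_toEquiv, this,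
      f.map_adj_iff]

namespace ParentTree

variable {V : Type} (R : ParentTree V)

theorem top_pair_eq_iff [DecidableEq V] {v : V} (hv : v ≠ R.root) (w : V) :
    R.top {R.root, v} w = v ↔ R.Desc v w := by
  have hS : R.root ∈ ({R.root, v} : Finset V) := by simp
  refine ⟨fun h => by simpa only [h] using R.desc_top hS w, ?_⟩
  refine R.induction (P := fun w => R.Desc v w → R.top {R.root, v} w = v) ?_ ?_ w
  · exact fun h => absurd (R.desc_root_right h) hv
  · intro w hw ih h
    by_cases hwv : w = v
    · rw [hwv]
      exact R.top_of_mem (by simp)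
    · rw [R.top_of_notMem hS (by simp [hw, hwv])]
      exact ih (h.eq_or_par.resolve_left hwv)

variable [Fintype V]

/-- The number of descendants of `v`. -/
noncomputable def sub (v : V) : ℕ := (Finset.univ.filter fun w => R.Desc v w).card

/-- The children of `v`. -/
noncomputable def children (v : V) : Finset V :=
  Finset.univ.filter fun w => w ≠ R.root ∧ R.par w = v

variable {R} in
theorem mem_children {v w : V} : w ∈ R.children v ↔ w ≠ R.root ∧ R.par w = v := by
  simp [children]

variable {R} in
theorem Desc.eq_or_child {v w : V} (h : R.Desc v w) :
    w = v ∨ ∃ u ∈ R.children v, R.Desc u w := by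
  revert h
  refine R.induction (P := fun w => R.Desc v w → w = v ∨ ∃ u ∈ R.children v, R.Desc u w) ?_ ?_ w
  · exact fun h => Or.inl (R.desc_root_right h).symm
  · intro w hw ih h
    rcases h.eq_or_par with h | h
    · exact Or.inl h
    · rcases ih h with h | ⟨u, hu, h⟩
      · exact Or.inr ⟨w, mem_children.2 ⟨hw, h⟩, Desc.refl R _⟩
      · exact Or.inr ⟨u, hu, h.of_par⟩

theorem sub_eq (v : V) : R.sub v = 1 + ∑ w ∈ R.children v, R.sub w := by
  have hset : (Finset.univ.filter fun w => R.Desc v w) =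
      insert v ((R.children v).biUnion fun u => Finset.univ.filter fun w => R.Desc u w) := by
    ext w
    simp only [Finset.mem_filter, Finset.mem_univ, true_and, Finset.mem_insert,
      Finset.mem_biUnion]
    refine ⟨Desc.eq_or_child, ?_⟩
    rintro (rfl | ⟨u, hu, h⟩)
    · exact Desc.refl R _
    · refine Desc.trans ?_ h
      rw [← (mem_children.1 hu).2]
      exact (Desc.refl R _).of_par
  rw [sub, hset, Finset.card_insert_of_notMem, Finset.card_biUnion, add_comm]
  · rfl
  · intro x hx y hy hxy
    rw [Function.onFun, Finset.disjoint_left]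
    intro w hw hw'
    simp only [Finset.mem_filter, Finset.mem_univ, true_and] at hw hw'
    rw [Finset.mem_coe, mem_children] at hx hy
    have h1 := R.depth_eq x hx.1
    have h2 := R.depth_eq y hy.1
    rw [hx.2] at h1
    rw [hy.2] at h2
    rcases hw.total hw' with h | h
    · exact hxy (h.depth_le.2 (by omega))
    · exact hxy (h.depth_le.2 (by omega)).symm
  · simp only [Finset.mem_filter, Finset.mem_univ, true_and, Finset.mem_biUnion]
    rintro ⟨u, hu, h⟩
    rw [mem_children] at hu
    have h1 := R.depth_eq u hu.1
    rw [hu.2] at h1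
    have := h.depth_le.1
    omega

theorem one_le_sub (v : V) : 1 ≤ R.sub v := by
  rw [sub_eq]
  omega

theorem sub_lt_sub_par {v : V} (hv : v ≠ R.root) : R.sub v < R.sub (R.par v) := by
  have := Finset.single_le_sum (f := R.sub) (fun _ _ => Nat.zero_le _)
    (mem_children.2 ⟨hv, rfl⟩ : v ∈ R.children (R.par v))
  rw [R.sub_eq (R.par v)]
  omega

theorem sub_root : R.sub R.root = Fintype.card V := by
  simp [sub, R.desc_root_left]

variable [DecidableEq V]

theorem card_fiber_le_sub {S : Finset V} (hS : R.root ∈ S) (a : V) :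
    (Finset.univ.filter fun v => R.top S v = a).card ≤ R.sub a := by
  refine Finset.card_le_card fun v hv => ?_
  simp only [Finset.mem_filter, Finset.mem_univ, true_and] at hv ⊢
  exact hv ▸ R.desc_top hS v

theorem sizes_pair {v : V} (hv : v ≠ R.root) :
    R.sizes {R.root, v} = {Fintype.card V - R.sub v, R.sub v} := by
  have h1 : (Finset.univ.filter fun w => R.top {R.root, v} w = v).card = R.sub v := by
    simp only [R.top_pair_eq_iff hv, sub]
  have h2 := R.sum_sizes (S := {R.root, v}) (by simp)
  have h3 : R.sizes {R.root, v} =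
      {(Finset.univ.filter fun w => R.top {R.root, v} w = R.root).card, R.sub v} := by
    rw [← h1, sizes, Finset.insert_val_of_notMem (by simpa using hv.symm)]
    simp
  rw [h3] at h2 ⊢
  simp only [Multiset.insert_eq_cons, Multiset.sum_cons, Multiset.sum_singleton] at h2
  rw [← h2, Nat.add_sub_cancel]

variable {R} in
theorem IsRootingOf.count_pair {G : SimpleGraph V} (hR : R.IsRootingOf G)
    (hsub : ∀ v, v ≠ R.root → 2 * R.sub v ≤ Fintype.card V) {s : ℕ}
    (hs : 2 * s ≤ Fintype.card V) :
    (UPoly G).count {Fintype.card V - s, s} = (Finset.univ.filter fun v => R.sub v = s).card := by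
  have hpos : 0 < Fintype.card V := Fintype.card_pos_iff.2 ⟨R.root⟩
  have hroot : ∀ v, R.sub v = s → v ≠ R.root := by
    rintro v h rfl
    rw [R.sub_root] at h
    omega
  rw [hR.count_UPoly]
  symm
  refine Finset.card_bij (fun v _ => {R.root, v}) ?_ ?_ ?_
  · intro v hv
    simp only [Finset.mem_filter, Finset.mem_univ, true_and] at hv ⊢
    rw [R.sizes_pair (hroot v hv), hv]
    simp
  · intro v hv w hw h
    simp only [Finset.mem_filter, Finset.mem_univ, true_and] at hv hw
    have : v ∈ ({R.root, w} : Finset V) := h ▸ (by simp)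
    simpa [hroot v hv] using this
  · intro S hS
    simp only [Finset.mem_filter, Finset.mem_univ, true_and] at hS
    have hc : S.card = 2 := by rw [← R.card_sizes, hS.2]; rfl
    have hc' : (S.erase R.root).card = 1 := by rw [Finset.card_erase_of_mem hS.1, hc]
    obtain ⟨v, hv⟩ := Finset.card_eq_one.1 hc'
    have hS' : S = {R.root, v} := by rw [← Finset.insert_erase hS.1, hv]
    have hv' : v ≠ R.root := Finset.ne_of_mem_erase (hv ▸ Finset.mem_singleton_self v :
      v ∈ S.erase R.root)
    refine ⟨v, ?_, hS'.symm⟩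
    simp only [Finset.mem_filter, Finset.mem_univ, true_and]
    have h := hS.2
    rw [hS', R.sizes_pair hv'] at h
    have hm : R.sub v ∈ ({Fintype.card V - s, s} : Multiset ℕ) := h ▸ (by simp)
    have := hsub v hv'
    simp only [Multiset.insert_eq_cons, Multiset.mem_cons, Multiset.mem_singleton] at hm
    omega

variable {R} in
theorem IsRootingOf.sum_eq_card {G : SimpleGraph V} (hR : R.IsRootingOf G) {l : Multiset ℕ}
    (hl : l ∈ UPoly G) : l.sum = Fintype.card V := by
  rw [hR.UPoly_eq, Multiset.mem_map] at hl
  obtain ⟨S, hS, rfl⟩ := hl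
  exact R.sum_sizes (by simpa using hS)

variable {R} in
theorem IsRootingOf.UPoly_ne_zero {G : SimpleGraph V} (hR : R.IsRootingOf G) : UPoly G ≠ 0 := by
  rw [hR.UPoly_eq]
  intro h
  have : (Finset.univ.filter fun S : Finset V => R.root ∈ S) = ∅ :=
    Finset.val_eq_zero.1 (Multiset.map_eq_zero.1 h)
  have h' : Finset.univ ∈ (Finset.univ.filter fun S : Finset V => R.root ∈ S) := by simp
  simp [this] at h'

/-- Cutting off the subtree `φ(B)` and then cutting inside it. -/
theorem sizes_insert_root_map {B : Type} [Fintype B] [DecidableEq B] (Q : ParentTree B)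
    (φ : B ↪ V) (hpar : ∀ b, b ≠ Q.root → R.par (φ b) = φ (Q.par b))
    (hroot : ∀ b, φ b ≠ R.root)
    (hclosed : ∀ w, w ≠ R.root → R.par w ∈ Set.range φ → w ∈ Set.range φ)
    {S : Finset B} (hS : Q.root ∈ S) :
    R.sizes (insert R.root (S.map φ)) = (Fintype.card V - Fintype.card B) ::ₘ Q.sizes S := by
  have hmem : ∀ b, φ b ∈ insert R.root (S.map φ) ↔ b ∈ S := by
    intro b
    simp [hroot]
  have hr : R.root ∈ insert R.root (S.map φ) := Finset.mem_insert_self _ _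
  have hin : ∀ b, R.top (insert R.root (S.map φ)) (φ b) = φ (Q.top S b) := by
    intro b
    refine Q.induction
      (P := fun b => R.top (insert R.root (S.map φ)) (φ b) = φ (Q.top S b)) ?_ ?_ b
    · rw [R.top_of_mem ((hmem _).2 hS), Q.top_of_mem hS]
    · intro b hb ih
      by_cases h : b ∈ S
      · rw [R.top_of_mem ((hmem _).2 h), Q.top_of_mem h]
      · rw [R.top_of_notMem hr (fun h' => h ((hmem _).1 h')), Q.top_of_notMem hS h, ← ih,
          hpar b hb]
  have hout : ∀ w, w ∉ Set.range φ → R.top (insert R.root (S.map φ)) w = R.root := by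
    intro w
    refine R.induction (P := fun w => w ∉ Set.range φ →
      R.top (insert R.root (S.map φ)) w = R.root) ?_ ?_ w
    · exact fun _ => R.top_of_mem hr
    · intro w hw ih h
      rw [R.top_of_notMem hr, ih fun h' => h (hclosed w hw h')]
      simp only [Finset.mem_insert, Finset.mem_map, not_or, not_exists]
      exact ⟨hw, fun b hb => h ⟨b, hb.2⟩⟩
  have hfib : ∀ a, (Finset.univ.filter fun v => R.top (insert R.root (S.map φ)) v = φ a).card =
      (Finset.univ.filter fun b => Q.top S b = a).card := by
    intro a
    rw [← Finset.card_map φ]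
    congr 1
    ext v
    simp only [Finset.mem_filter, Finset.mem_univ, true_and, Finset.mem_map]
    constructor
    · intro h
      by_cases hv : v ∈ Set.range φ
      · obtain ⟨b, rfl⟩ := hv
        rw [hin] at h
        exact ⟨b, φ.injective h, rfl⟩
      · rw [hout v hv] at h
        exact absurd h.symm (hroot a)
    · rintro ⟨b, rfl, rfl⟩
      exact hin b
  have hsum := R.sum_sizes hr
  have hval : R.sizes (insert R.root (S.map φ)) =
      (Finset.univ.filter fun v => R.top (insert R.root (S.map φ)) v = R.root).card ::ₘ
        Q.sizes S := by
    rw [sizes, Finset.insert_val_of_notMem (by simp [hroot])]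
    simp only [Multiset.map_cons, Finset.map_val, Multiset.map_map, Function.comp_def, hfib, sizes]
  rw [hval] at hsum ⊢
  rw [Multiset.sum_cons, Q.sum_sizes hS] at hsum
  rw [← hsum, Nat.add_sub_cancel]

end ParentTree

open ParentTree in
/-- Rooting a tree at a vertex minimizing the sum of distances. -/
theorem exists_balanced_rooting {V : Type} [Fintype V] {G : SimpleGraph V} (hG : G.IsTree) :
    ∃ R : ParentTree V, R.IsRootingOf G ∧
      ∀ v, v ≠ R.root → 2 * R.sub v ≤ Fintype.card V := by
  have hconn := hG.connected
  have : Nonempty V := hconn.nonempty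
  obtain ⟨c, hc⟩ := Finite.exists_min fun c => ∑ x, G.dist c x
  have hnext : ∀ v, v ≠ c → ∃ w, G.Adj v w ∧ G.dist c v = G.dist c w + 1 := by
    intro v hv
    obtain ⟨p, hp⟩ := hconn.exists_walk_length_eq_dist v c
    cases p with
    | nil => exact absurd rfl hv
    | cons h q =>
      rename_i w
      refine ⟨w, h, ?_⟩
      have h1 := SimpleGraph.dist_le q
      have h2 : G.dist v c ≤ G.dist v w + G.dist w c := hconn.dist_triangle
      rw [SimpleGraph.dist_eq_one_iff_adj.2 h] at h2
      rw [SimpleGraph.Walk.length_cons] at hp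
      rw [G.dist_comm (u := c) (v := v), G.dist_comm (u := c) (v := w)]
      omega
  choose! f hf using hnext
  let R : ParentTree V :=
    { root := c
      par := fun v => if v = c then c else f v
      depth := G.dist c
      par_root := by simp
      depth_root := by simp
      depth_eq := fun v hv => by simpa [hv] using (hf v hv).2 }
  have hpar : ∀ v, v ≠ R.root → R.par v = f v := fun v hv => if_neg hv
  have hedges : (Finset.univ.erase R.root).image (fun v => s(v, R.par v)) = G.edgeFinset := by
    refine Finset.eq_of_subset_of_card_le ?_ ?_
    · intro e he
      obtain ⟨v, hv, rfl⟩ := Finset.mem_image.1 he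
      have hv := Finset.ne_of_mem_erase hv
      rw [hpar v hv]
      simpa using (hf v hv).1
    · rw [Finset.card_image_of_injOn, Finset.card_erase_of_mem (Finset.mem_univ _)]
      · have := hG.card_edgeFinset
        rw [Finset.card_univ]
        omega
      · intro u hu v hv h
        exact R.edge_injOn (Finset.ne_of_mem_erase hu) (Finset.ne_of_mem_erase hv) h
  have hR : R.IsRootingOf G := by
    intro u v
    rw [← SimpleGraph.mem_edgeSet, ← SimpleGraph.mem_edgeFinset, ← hedges, Finset.mem_image]
    constructor
    · rintro ⟨w, hw, h⟩
      have hw := Finset.ne_of_mem_erase hw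
      rcases Sym2.eq_iff.1 h with ⟨rfl, rfl⟩ | ⟨rfl, rfl⟩
      · exact Or.inl ⟨hw, rfl⟩
      · exact Or.inr ⟨hw, rfl⟩
    · rintro (⟨hu, rfl⟩ | ⟨hv, rfl⟩)
      · exact ⟨u, by simp [hu], rfl⟩
      · exact ⟨v, by simp [hv], Sym2.eq_swap⟩
  refine ⟨R, hR, fun v => ?_⟩
  refine R.induction (P := fun v => v ≠ R.root → 2 * R.sub v ≤ Fintype.card V) ?_ ?_ v
  · exact fun h => absurd rfl h
  · intro v hv ih _
    by_cases hp : R.par v = R.root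
    · have hdesc : ∀ x, R.Desc v x → G.dist v x + G.dist c v ≤ G.dist c x := by
        intro x
        refine R.induction
          (P := fun x => R.Desc v x → G.dist v x + G.dist c v ≤ G.dist c x) ?_ ?_ x
        · exact fun h => absurd (R.desc_root_right h) hv
        · intro x hx ih h
          rcases h.eq_or_par with rfl | h
          · simp
          · have h1 := ih h
            have h2 : G.dist v x ≤ G.dist v (R.par x) + G.dist (R.par x) x := hconn.dist_triangle
            rw [SimpleGraph.dist_eq_one_iff_adj.2 (hR.adj_par hx).symm] at h2
            have h3 : G.dist c x = G.dist c (R.par x) + 1 := R.depth_eq x hx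
            omega
      have hadj : G.Adj v c := by simpa [hp] using hR.adj_par hv
      have hle : ∀ x, G.dist v x + 2 * (if R.Desc v x then 1 else 0) ≤ G.dist c x + 1 := by
        intro x
        split_ifs with h
        · have := hdesc x h
          rw [SimpleGraph.dist_eq_one_iff_adj.2 hadj.symm] at this
          omega
        · have h2 : G.dist v x ≤ G.dist v c + G.dist c x := hconn.dist_triangle
          rw [SimpleGraph.dist_eq_one_iff_adj.2 hadj] at h2
          omega
      have hsum := Finset.sum_le_sum fun x (_ : x ∈ Finset.univ) => hle x
      rw [Finset.sum_add_distrib, Finset.sum_add_distrib, ← Finset.mul_sum,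
        Finset.sum_boole] at hsum
      have := hc v
      simp only [Finset.sum_const, Finset.card_univ, smul_eq_mul, mul_one, Nat.cast_id] at hsum
      rw [sub]
      omega
    · have := R.sub_lt_sub_par hv
      have := ih hp
      omega

/-- The vertices of the branch `B(q,s)`. -/
abbrev BranchVtx (q s : ℕ) : Type := Unit ⊕ (Fin q × Fin 3 ⊕ Fin s × Fin 3)

/-- The rooted tree `B(q,s)`. -/
def branchTree (q s : ℕ) : ParentTree (BranchVtx q s) where
  root := Sum.inl ()
  par
    | Sum.inl () => Sum.inl ()
    | Sum.inr (Sum.inl (_, 0)) => Sum.inl ()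
    | Sum.inr (Sum.inl (j, 1)) => Sum.inr (Sum.inl (j, 0))
    | Sum.inr (Sum.inl (j, 2)) => Sum.inr (Sum.inl (j, 1))
    | Sum.inr (Sum.inr (_, 0)) => Sum.inl ()
    | Sum.inr (Sum.inr (j, 1)) => Sum.inr (Sum.inr (j, 0))
    | Sum.inr (Sum.inr (j, 2)) => Sum.inr (Sum.inr (j, 0))
  depth
    | Sum.inl () => 0
    | Sum.inr (Sum.inl (_, l)) => l.1 + 1
    | Sum.inr (Sum.inr (_, 0)) => 1
    | Sum.inr (Sum.inr (_, 1)) => 2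
    | Sum.inr (Sum.inr (_, 2)) => 2
  par_root := rfl
  depth_root := rfl
  depth_eq := by
    rintro (_ | ⟨j, l⟩ | ⟨j, l⟩) h
    · exact absurd rfl h
    · fin_cases l <;> rfl
    · fin_cases l <;> rfl

/-- The tree `T(p,s)` rooted at its central vertex. -/
def tpsTree (n : ℕ) (p s : Fin n → ℕ) : ParentTree (Vtx n p s) where
  root := Sum.inl ()
  par
    | Sum.inl () => Sum.inl ()
    | Sum.inr (Sum.inl _) => Sum.inl ()
    | Sum.inr (Sum.inr (Sum.inl ⟨i, _, 0⟩)) => Sum.inr (Sum.inl i)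
    | Sum.inr (Sum.inr (Sum.inl ⟨i, j, 1⟩)) => Sum.inr (Sum.inr (Sum.inl ⟨i, j, 0⟩))
    | Sum.inr (Sum.inr (Sum.inl ⟨i, j, 2⟩)) => Sum.inr (Sum.inr (Sum.inl ⟨i, j, 1⟩))
    | Sum.inr (Sum.inr (Sum.inr ⟨i, _, 0⟩)) => Sum.inr (Sum.inl i)
    | Sum.inr (Sum.inr (Sum.inr ⟨i, j, 1⟩)) => Sum.inr (Sum.inr (Sum.inr ⟨i, j, 0⟩))
    | Sum.inr (Sum.inr (Sum.inr ⟨i, j, 2⟩)) => Sum.inr (Sum.inr (Sum.inr ⟨i, j, 0⟩))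
  depth
    | Sum.inl () => 0
    | Sum.inr (Sum.inl _) => 1
    | Sum.inr (Sum.inr (Sum.inl ⟨_, _, l⟩)) => l.1 + 2
    | Sum.inr (Sum.inr (Sum.inr ⟨_, _, 0⟩)) => 2
    | Sum.inr (Sum.inr (Sum.inr ⟨_, _, 1⟩)) => 3
    | Sum.inr (Sum.inr (Sum.inr ⟨_, _, 2⟩)) => 3
  par_root := rfl
  depth_root := rfl
  depth_eq := by
    rintro (_ | i | ⟨i, j, l⟩ | ⟨i, j, l⟩) h
    · exact absurd rfl h
    · rfl
    · fin_cases l <;> rfl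
    · fin_cases l <;> rfl

theorem tpsTree_isRootingOf (n : ℕ) (p s : Fin n → ℕ) :
    (tpsTree n p s).IsRootingOf (TpsGraph n p s) := by
  have hrel : ∀ u v, TRel n p s u v ↔ v ≠ (tpsTree n p s).root ∧ (tpsTree n p s).par v = u := by
    intro u v
    constructor
    · rintro (i | ⟨i, j⟩ | ⟨i, j, l⟩ | ⟨i, j⟩ | ⟨i, j, l⟩)
      · exact ⟨nofun, rfl⟩
      · exact ⟨nofun, rfl⟩
      · fin_cases l <;> exact ⟨nofun, rfl⟩
      · exact ⟨nofun, rfl⟩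
      · fin_cases l <;> exact ⟨nofun, rfl⟩
    · rintro ⟨h, rfl⟩
      rcases v with (_ | i | ⟨i, j, l⟩ | ⟨i, j, l⟩)
      · exact absurd rfl h
      · exact .core i
      · fin_cases l
        · exact .pathRoot i j
        · exact .pathEdge i j 0
        · exact .pathEdge i j 1
      · fin_cases l
        · exact .starRoot i j
        · exact .starEdge i j 0
        · exact .starEdge i j 1
  intro u v
  rw [TpsGraph, SimpleGraph.fromRel_adj, hrel, hrel, or_comm, and_iff_right_iff_imp]
  rintro (⟨h, h'⟩ | ⟨h, h'⟩) rfl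
  · have := (tpsTree n p s).depth_eq u h
    rw [h'] at this
    omega
  · have := (tpsTree n p s).depth_eq u h
    rw [h'] at this
    omega

section

variable {n : ℕ} {p s : Fin n → ℕ}

/-- The inclusion of the `i`-th branch. -/
def branchEmb (i : Fin n) : BranchVtx (p i) (s i) ↪ Vtx n p s where
  toFun
    | Sum.inl () => Sum.inr (Sum.inl i)
    | Sum.inr (Sum.inl (j, l)) => Sum.inr (Sum.inr (Sum.inl ⟨i, j, l⟩))
    | Sum.inr (Sum.inr (j, l)) => Sum.inr (Sum.inr (Sum.inr ⟨i, j, l⟩))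
  inj' := by
    rintro (_ | ⟨j, l⟩ | ⟨j, l⟩) (_ | ⟨j', l'⟩ | ⟨j', l'⟩) h <;> cases h <;> rfl

theorem par_branchEmb (i : Fin n) (b : BranchVtx (p i) (s i))
    (hb : b ≠ (branchTree (p i) (s i)).root) :
    (tpsTree n p s).par (branchEmb i b) = branchEmb i ((branchTree (p i) (s i)).par b) := by
  rcases b with (_ | ⟨j, l⟩ | ⟨j, l⟩)
  · exact absurd rfl hb
  · fin_cases l <;> rfl
  · fin_cases l <;> rfl

theorem branchEmb_ne_root (i : Fin n) (b : BranchVtx (p i) (s i)) :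
    branchEmb i b ≠ (tpsTree n p s).root := by
  rcases b with (_ | ⟨j, l⟩ | ⟨j, l⟩) <;> exact nofun

theorem branchEmb_index {i i' : Fin n} {b : BranchVtx (p i) (s i)} {b' : BranchVtx (p i') (s i')}
    (h : branchEmb i b = branchEmb i' b') : i = i' := by
  rcases b with (_ | ⟨j, l⟩ | ⟨j, l⟩) <;> rcases b' with (_ | ⟨j', l'⟩ | ⟨j', l'⟩) <;>
    cases h <;> rfl

theorem mem_range_branchEmb_of_par (i : Fin n) (w : Vtx n p s) (hw : w ≠ (tpsTree n p s).root)
    (h : (tpsTree n p s).par w ∈ Set.range (branchEmb i)) : w ∈ Set.range (branchEmb i) := by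
  obtain ⟨b, hb⟩ := h
  have key : ∀ i', (∃ b', branchEmb i' b' = w) → (∃ b'', branchEmb i' b'' = (tpsTree n p s).par w) →
      w ∈ Set.range (branchEmb i) := by
    rintro i' ⟨b', rfl⟩ ⟨b'', h''⟩
    obtain rfl := branchEmb_index (hb.trans h''.symm)
    exact ⟨b', rfl⟩
  rcases w with (_ | i' | ⟨i', j, l⟩ | ⟨i', j, l⟩)
  · exact absurd rfl hw
  · exact absurd hb (branchEmb_ne_root i b)
  · refine key i' ⟨Sum.inr (Sum.inl (j, l)), rfl⟩ ?_
    fin_cases l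
    · exact ⟨Sum.inl (), rfl⟩
    · exact ⟨Sum.inr (Sum.inl (j, 0)), rfl⟩
    · exact ⟨Sum.inr (Sum.inl (j, 1)), rfl⟩
  · refine key i' ⟨Sum.inr (Sum.inr (j, l)), rfl⟩ ?_
    fin_cases l
    · exact ⟨Sum.inl (), rfl⟩
    · exact ⟨Sum.inr (Sum.inr (j, 0)), rfl⟩
    · exact ⟨Sum.inr (Sum.inr (j, 0)), rfl⟩

/-- A descendant-closed set determines the number of descendants. -/
theorem ParentTree.sub_eq_card {V : Type} [Fintype V] (R : ParentTree V) {v : V} {X : Finset V}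
    (hX : ∀ w ∈ X, R.Desc v w) (hv : v ∈ X) (hclosed : ∀ w, w ≠ R.root → R.par w ∈ X → w ∈ X) :
    R.sub v = X.card := by
  rw [sub]
  congr 1
  ext w
  simp only [Finset.mem_filter, Finset.mem_univ, true_and]
  refine ⟨?_, hX w⟩
  refine R.induction (P := fun w => R.Desc v w → w ∈ X) ?_ ?_ w
  · exact fun h => R.desc_root_right h ▸ hv
  · intro w hw ih h
    rcases h.eq_or_par with rfl | h
    · exact hv
    · exact hclosed w hw (ih h)

theorem card_branchVtx (q s : ℕ) : Fintype.card (BranchVtx q s) = 3 * (q + s) + 1 := by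
  simp
  ring

/-- The number of descendants of a vertex of `B(q,s)`. -/
def branchSub {q s : ℕ} : BranchVtx q s → ℕ
  | Sum.inl () => 3 * (q + s) + 1
  | Sum.inr (Sum.inl (_, l)) => 3 - l.1
  | Sum.inr (Sum.inr (_, 0)) => 3
  | Sum.inr (Sum.inr (_, 1)) => 1
  | Sum.inr (Sum.inr (_, 2)) => 1

theorem sub_branchTree {q s : ℕ} (b : BranchVtx q s) : (branchTree q s).sub b = branchSub b := by
  have key : ∀ X : Finset (BranchVtx q s), X.card = branchSub b →
      (∀ w ∈ X, (branchTree q s).Desc b w) → b ∈ X →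
      (∀ w, w ≠ (branchTree q s).root → (branchTree q s).par w ∈ X → w ∈ X) →
      (branchTree q s).sub b = branchSub b := fun X hc hX hb hcl =>
    ((branchTree q s).sub_eq_card hX hb hcl).trans hc
  rcases b with (_ | ⟨j, l⟩ | ⟨j, l⟩)
  · rw [show Sum.inl _ = (branchTree q s).root from rfl, ParentTree.sub_root, card_branchVtx]
    rfl
  · fin_cases l
    · refine key {Sum.inr (Sum.inl (j, 0)), Sum.inr (Sum.inl (j, 1)), Sum.inr (Sum.inl (j, 2))}
        (by simp [branchSub]) ?_ (by simp) ?_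
      · simp only [Finset.mem_insert, Finset.mem_singleton]
        rintro w (rfl | rfl | rfl)
        exacts [⟨0, rfl⟩, ⟨1, rfl⟩, ⟨2, rfl⟩]
      · rintro (_ | ⟨j', l'⟩ | ⟨j', l'⟩) <;>
          (try fin_cases l') <;> simp [branchTree]
    · refine key {Sum.inr (Sum.inl (j, 1)), Sum.inr (Sum.inl (j, 2))}
        (by simp [branchSub]) ?_ (by simp) ?_
      · simp only [Finset.mem_insert, Finset.mem_singleton]
        rintro w (rfl | rfl)
        exacts [⟨0, rfl⟩, ⟨1, rfl⟩]
      · rintro (_ | ⟨j', l'⟩ | ⟨j', l'⟩) <;>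
          (try fin_cases l') <;> simp [branchTree]
    · refine key {Sum.inr (Sum.inl (j, 2))} (by simp [branchSub]) ?_ (by simp) ?_
      · simp only [Finset.mem_singleton]
        rintro w rfl
        exact ⟨0, rfl⟩
      · rintro (_ | ⟨j', l'⟩ | ⟨j', l'⟩) <;>
          (try fin_cases l') <;> simp [branchTree]
  · fin_cases l
    · refine key {Sum.inr (Sum.inr (j, 0)), Sum.inr (Sum.inr (j, 1)), Sum.inr (Sum.inr (j, 2))}
        (by simp [branchSub]) ?_ (by simp) ?_
      · simp only [Finset.mem_insert, Finset.mem_singleton]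
        rintro w (rfl | rfl | rfl)
        exacts [⟨0, rfl⟩, ⟨1, rfl⟩, ⟨1, rfl⟩]
      · rintro (_ | ⟨j', l'⟩ | ⟨j', l'⟩) <;>
          (try fin_cases l') <;> simp [branchTree]
    · refine key {Sum.inr (Sum.inr (j, 1))} (by simp [branchSub]) ?_ (by simp) ?_
      · simp only [Finset.mem_singleton]
        rintro w rfl
        exact ⟨0, rfl⟩
      · rintro (_ | ⟨j', l'⟩ | ⟨j', l'⟩) <;>
          (try fin_cases l') <;> simp [branchTree]
    · refine key {Sum.inr (Sum.inr (j, 2))} (by simp [branchSub]) ?_ (by simp) ?_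
      · simp only [Finset.mem_singleton]
        rintro w rfl
        exact ⟨0, rfl⟩
      · rintro (_ | ⟨j', l'⟩ | ⟨j', l'⟩) <;>
          (try fin_cases l') <;> simp [branchTree]

theorem sub_branchEmb (i : Fin n) (b : BranchVtx (p i) (s i)) :
    (tpsTree n p s).sub (branchEmb i b) = (branchTree (p i) (s i)).sub b := by
  set Q := branchTree (p i) (s i)
  have hdesc : ∀ x, Q.Desc b x → (tpsTree n p s).Desc (branchEmb i b) (branchEmb i x) := by
    refine Q.induction ?_ ?_
    · intro h
      rw [Q.desc_root_right h]
      exact .refl _ _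
    · intro x hx ih h
      rcases h.eq_or_par with rfl | h
      · exact .refl _ _
      · refine .of_par ?_
        rw [par_branchEmb i x hx]
        exact ih h
  rw [ParentTree.sub_eq_card (X := (Finset.univ.filter fun x => Q.Desc b x).map (branchEmb i)),
    Finset.card_map]
  · rfl
  · intro w hw
    obtain ⟨x, hx, rfl⟩ := Finset.mem_map.1 hw
    exact hdesc x (Finset.mem_filter.1 hx).2
  · exact Finset.mem_map_of_mem _ (by simpa using ParentTree.Desc.refl Q b)
  · intro w hw h
    obtain ⟨x, hx, hxw⟩ := Finset.mem_map.1 h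
    obtain ⟨y, rfl⟩ := mem_range_branchEmb_of_par i w hw ⟨x, hxw⟩
    refine Finset.mem_map_of_mem _ ?_
    by_cases hy : y = Q.root
    · subst hy
      exact absurd hxw (branchEmb_ne_root i x)
    · rw [par_branchEmb i y hy, (branchEmb i).apply_eq_iff_eq] at hxw
      subst hxw
      simp only [Finset.mem_filter, Finset.mem_univ, true_and] at hx ⊢
      exact .of_par hx

/-- The number of descendants of a vertex of `T(p,s)` other than its centre. -/
def tpsSub : Vtx n p s → ℕ
  | Sum.inl () => 0
  | Sum.inr (Sum.inl i) => 3 * (p i + s i) + 1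
  | Sum.inr (Sum.inr (Sum.inl ⟨_, _, l⟩)) => 3 - l.1
  | Sum.inr (Sum.inr (Sum.inr ⟨_, _, 0⟩)) => 3
  | Sum.inr (Sum.inr (Sum.inr ⟨_, _, 1⟩)) => 1
  | Sum.inr (Sum.inr (Sum.inr ⟨_, _, 2⟩)) => 1

theorem sub_tpsTree (v : Vtx n p s) (hv : v ≠ (tpsTree n p s).root) :
    (tpsTree n p s).sub v = tpsSub v := by
  rcases v with (_ | i | ⟨i, j, l⟩ | ⟨i, j, l⟩)
  · exact absurd rfl hv
  · exact (sub_branchEmb i (Sum.inl ())).trans (sub_branchTree _)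
  · exact (sub_branchEmb i (Sum.inr (Sum.inl (j, l)))).trans (sub_branchTree _)
  · refine (sub_branchEmb i (Sum.inr (Sum.inr (j, l)))).trans ((sub_branchTree _).trans ?_)
    fin_cases l <;> rfl

end

theorem ParentTree.Desc.desc_top {V : Type} [DecidableEq V] {R : ParentTree V} {S : Finset V}
    (hS : R.root ∈ S) {b w : V} (hb : b ∈ S) (h : R.Desc b w) : R.Desc b (R.top S w) := by
  revert h
  refine R.induction (P := fun w => R.Desc b w → R.Desc b (R.top S w)) ?_ ?_ w
  · rw [R.top_of_mem hS]
    exact id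
  · intro w hw ih h
    by_cases hwS : w ∈ S
    · rwa [R.top_of_mem hwS]
    · rw [R.top_of_notMem hS hwS]
      rcases h.eq_or_par with rfl | h
      · exact absurd hb hwS
      · exact ih h

section

variable {n : ℕ} {p s : Fin n → ℕ} {α : ℕ}

theorem card_vtx (h : ∀ i, p i + s i = α) : Fintype.card (Vtx n p s) = 1 + n * (3 * α + 1) := by
  have : ∑ i, p i + ∑ i, s i = n * α := by
    rw [← Finset.sum_add_distrib, Finset.sum_congr rfl fun i _ => h i]
    simp
  simp only [Fintype.card_sum, Fintype.card_unit, Fintype.card_fin, Fintype.card_sigma,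
    Fintype.card_prod, ← Finset.sum_mul]
  linarith

theorem tpsSub_cases (h : ∀ i, p i + s i = α) (v : Vtx n p s) (hv : v ≠ (tpsTree n p s).root) :
    (∃ i, v = branchEmb i (Sum.inl ()) ∧ tpsSub v = 3 * α + 1) ∨
      tpsSub v = 1 ∨ tpsSub v = 2 ∨ tpsSub v = 3 := by
  rcases v with (_ | i | ⟨i, j, l⟩ | ⟨i, j, l⟩)
  · exact absurd rfl hv
  · refine Or.inl ⟨i, rfl, ?_⟩
    rw [tpsSub, h]
  · fin_cases l <;> simp [tpsSub]
  · fin_cases l <;> simp [tpsSub]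

theorem count_UPoly_cons (hn : 2 ≤ n) (hα : 0 < α) (h : ∀ i, p i + s i = α) {l : Multiset ℕ} {r : ℕ}
    (hr : 4 ≤ r) (hrl : r ∈ l) :
    (UPoly (TpsGraph n p s)).count ((Fintype.card (Vtx n p s) - (3 * α + 1)) ::ₘ l) =
      ∑ i, (Finset.univ.filter fun S => (branchTree (p i) (s i)).root ∈ S ∧
        (branchTree (p i) (s i)).sizes S = l).card := by
  have hN := card_vtx h
  have hNm : 3 * α + 1 < Fintype.card (Vtx n p s) - (3 * α + 1) := by
    have : 2 * (3 * α + 1) ≤ n * (3 * α + 1) := Nat.mul_le_mul_right _ hn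
    omega
  have hsizes : ∀ (i : Fin n) {S : Finset (BranchVtx (p i) (s i))},
      (branchTree (p i) (s i)).root ∈ S →
      (tpsTree n p s).sizes (insert (tpsTree n p s).root (S.map (branchEmb i))) =
        (Fintype.card (Vtx n p s) - (3 * α + 1)) ::ₘ (branchTree (p i) (s i)).sizes S := by
    intro i S hS
    rw [(tpsTree n p s).sizes_insert_root_map _ (branchEmb i) (par_branchEmb i)
      (branchEmb_ne_root i) (mem_range_branchEmb_of_par i) hS, card_branchVtx, h]
  rw [(tpsTree_isRootingOf n p s).count_UPoly, ← Finset.card_sigma]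
  symm
  refine Finset.card_bij (fun x _ => insert (tpsTree n p s).root (x.2.map (branchEmb x.1))) ?_ ?_ ?_
  · rintro ⟨i, S⟩ hS
    simp only [Finset.mem_sigma, Finset.mem_filter, Finset.mem_univ, true_and] at hS
    simp only [Finset.mem_filter, Finset.mem_univ, true_and, Finset.mem_insert, true_or]
    rw [hsizes i hS.1, hS.2]
  · rintro ⟨i, S⟩ hS ⟨i', S'⟩ hS' he
    simp only [Finset.mem_sigma, Finset.mem_filter, Finset.mem_univ, true_and] at hS hS'
    have hmap : S.map (branchEmb i) = S'.map (branchEmb i') := by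
      have hnot : ∀ i (S : Finset (BranchVtx (p i) (s i))),
          (tpsTree n p s).root ∉ S.map (branchEmb i) := by
        intro i S hm
        obtain ⟨b, -, hb⟩ := Finset.mem_map.1 hm
        exact branchEmb_ne_root i b hb
      rw [← Finset.erase_insert (hnot i S), ← Finset.erase_insert (hnot i' S')]
      exact congrArg (fun X => Finset.erase X _) he
    have hm : branchEmb i (branchTree (p i) (s i)).root ∈ S'.map (branchEmb i') :=
      hmap ▸ Finset.mem_map_of_mem _ hS.1
    obtain ⟨b, -, hb⟩ := Finset.mem_map.1 hm
    obtain rfl := branchEmb_index hb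
    rw [Finset.map_injective _ hmap]
  · intro S hS
    simp only [Finset.mem_filter, Finset.mem_univ, true_and] at hS
    obtain ⟨hroot, hS⟩ := hS
    have hfiber : ∀ a ≠ (tpsTree n p s).root,
        (Finset.univ.filter fun v => (tpsTree n p s).top S v = a).card ≤ tpsSub a := by
      intro a ha
      rw [← sub_tpsTree a ha]
      exact (tpsTree n p s).card_fiber_le_sub hroot a
    obtain ⟨a, haS, ha⟩ := Multiset.mem_map.1 (hS ▸ Multiset.mem_cons_self _ _ :
      _ ∈ (tpsTree n p s).sizes S)
    obtain rfl : a = (tpsTree n p s).root := by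
      by_contra hne
      have h1 := hfiber a hne
      rcases tpsSub_cases h a hne with ⟨i, -, h2⟩ | h2 <;> omega
    rw [ParentTree.sizes, ← Multiset.cons_erase haS, Multiset.map_cons, ha,
      Multiset.cons_inj_right] at hS
    obtain ⟨b, hbS, hb⟩ := Multiset.mem_map.1 (hS ▸ hrl)
    have hbS' : b ∈ S.erase (tpsTree n p s).root := hbS
    obtain ⟨hbr, hbS⟩ := Finset.mem_erase.1 hbS'
    have hb4 := hfiber b hbr
    rcases tpsSub_cases h b hbr with ⟨i, rfl, -⟩ | h2
    swap
    · omega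
    have hdesc : ∀ x : BranchVtx (p i) (s i),
        (tpsTree n p s).Desc (branchEmb i (Sum.inl ())) (branchEmb i x) := by
      rintro (_ | ⟨j, l⟩ | ⟨j, l⟩)
      · exact ⟨0, rfl⟩
      · fin_cases l
        exacts [⟨1, rfl⟩, ⟨2, rfl⟩, ⟨3, rfl⟩]
      · fin_cases l
        exacts [⟨1, rfl⟩, ⟨2, rfl⟩, ⟨2, rfl⟩]
    have hcompl : (Finset.univ.filter fun v =>
        (tpsTree n p s).top S v = (tpsTree n p s).root) = (Finset.univ.map (branchEmb i))ᶜ := by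
      refine Finset.eq_of_subset_of_card_le ?_ ?_
      · intro w hw
        simp only [Finset.mem_filter, Finset.mem_univ, true_and] at hw
        rw [Finset.mem_compl]
        intro hm
        obtain ⟨x, -, rfl⟩ := Finset.mem_map.1 hm
        have := (hdesc x).desc_top hroot hbS
        rw [hw] at this
        exact hbr ((tpsTree n p s).desc_root_right this)
      · rw [ha, Finset.card_compl, Finset.card_map, Finset.card_univ, card_branchVtx, h]
    have hSrange : ∀ w ∈ S, w ≠ (tpsTree n p s).root → ∃ x, branchEmb i x = w := by
      intro w hw hne
      by_contra hx
      have : w ∈ (Finset.univ.map (branchEmb i))ᶜ := by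
        rw [Finset.mem_compl, Finset.mem_map]
        rintro ⟨x, -, hx'⟩
        exact hx ⟨x, hx'⟩
      rw [← hcompl, Finset.mem_filter, (tpsTree n p s).top_of_mem hw] at this
      exact hne this.2
    have hSeq : insert (tpsTree n p s).root
        ((Finset.univ.filter fun x => branchEmb i x ∈ S).map (branchEmb i)) = S := by
      ext w
      simp only [Finset.mem_insert, Finset.mem_map, Finset.mem_filter, Finset.mem_univ, true_and]
      constructor
      · rintro (rfl | ⟨x, hx, rfl⟩)
        exacts [hroot, hx]
      · intro hw
        by_cases hne : w = (tpsTree n p s).root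
        · exact Or.inl hne
        · obtain ⟨x, rfl⟩ := hSrange w hw hne
          exact Or.inr ⟨x, hw, rfl⟩
    have hr' : (branchTree (p i) (s i)).root ∈
        Finset.univ.filter fun x => branchEmb i x ∈ S := by
      exact Finset.mem_filter.2 ⟨Finset.mem_univ _, hbS⟩
    refine ⟨⟨i, Finset.univ.filter fun x => branchEmb i x ∈ S⟩, ?_, hSeq⟩
    simp only [Finset.mem_sigma, Finset.mem_univ, true_and]
    refine Finset.mem_filter.2 ⟨Finset.mem_univ _, hr', ?_⟩
    have h3 := hsizes i hr'
    rw [hSeq, ParentTree.sizes, ← Multiset.cons_erase haS, Multiset.map_cons, ha,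
      Multiset.cons_inj_right] at h3
    exact h3.symm.trans hS

theorem two_mul_sub_tpsTree_le (hn : 2 ≤ n) (hα : 0 < α) (h : ∀ i, p i + s i = α) (v : Vtx n p s)
    (hv : v ≠ (tpsTree n p s).root) : 2 * (tpsTree n p s).sub v ≤ Fintype.card (Vtx n p s) := by
  have : 2 * (3 * α + 1) ≤ n * (3 * α + 1) := Nat.mul_le_mul_right _ hn
  rw [sub_tpsTree v hv, card_vtx h]
  rcases tpsSub_cases h v hv with ⟨i, -, h2⟩ | h2 <;> omega

theorem card_sub_tpsTree_eq (k : ℕ) (hk : 0 < k) (hk' : k < Fintype.card (Vtx n p s)) :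
    (Finset.univ.filter fun v => (tpsTree n p s).sub v = k).card =
      ∑ v : Vtx n p s, if tpsSub v = k then 1 else 0 := by
  rw [Finset.card_filter]
  refine Finset.sum_congr rfl fun v _ => ?_
  by_cases hv : v = (tpsTree n p s).root
  · subst hv
    rw [(tpsTree n p s).sub_root, if_neg (by omega), if_neg]
    change ¬ 0 = k
    omega
  · rw [sub_tpsTree v hv]

theorem card_sub_tpsTree_two (hn : 2 ≤ n) (hα : 0 < α) (h : ∀ i, p i + s i = α) :
    (Finset.univ.filter fun v => (tpsTree n p s).sub v = 2).card = ∑ i, p i := by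
  have : 2 * (3 * α + 1) ≤ n * (3 * α + 1) := Nat.mul_le_mul_right _ hn
  rw [card_sub_tpsTree_eq 2 (by omega) (by rw [card_vtx h]; omega)]
  have hne : ¬ 3 * α + 1 = 2 := by omega
  simp only [Fintype.sum_sum_type, Fintype.sum_sigma, Fintype.sum_prod_type, Fin.sum_univ_three]
  simp [tpsSub, h, hne]

theorem card_sub_tpsTree_three (hn : 2 ≤ n) (hα : 0 < α) (h : ∀ i, p i + s i = α) :
    (Finset.univ.filter fun v => (tpsTree n p s).sub v = 3).card = n * α := by
  have : 2 * (3 * α + 1) ≤ n * (3 * α + 1) := Nat.mul_le_mul_right _ hn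
  rw [card_sub_tpsTree_eq 3 (by omega) (by rw [card_vtx h]; omega)]
  have hne : ¬ 3 * α + 1 = 3 := by omega
  have : ∑ i, p i + ∑ i, s i = n * α := by
    rw [← Finset.sum_add_distrib, Finset.sum_congr rfl fun i _ => h i]
    simp
  simp only [Fintype.sum_sum_type, Fintype.sum_sigma, Fintype.sum_prod_type, Fin.sum_univ_three]
  simp [tpsSub, h, hne, this]

theorem card_sub_tpsTree_branch (hn : 2 ≤ n) (hα : 0 < α) (h : ∀ i, p i + s i = α) :
    (Finset.univ.filter fun v => (tpsTree n p s).sub v = 3 * α + 1).card = n := by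
  have : 2 * (3 * α + 1) ≤ n * (3 * α + 1) := Nat.mul_le_mul_right _ hn
  rw [card_sub_tpsTree_eq (3 * α + 1) (by omega) (by rw [card_vtx h]; omega)]
  have h2 : ¬ 2 = 3 * α + 1 := by omega
  have h3 : ¬ 3 = 3 * α + 1 := by omega
  simp only [Fintype.sum_sum_type, Fintype.sum_sigma, Fintype.sum_prod_type, Fin.sum_univ_three]
  simp [tpsSub, h, h2, h3, hα.ne']

theorem sub_tpsTree_cases (h : ∀ i, p i + s i = α) (v : Vtx n p s)
    (hv : v ≠ (tpsTree n p s).root) : (tpsTree n p s).sub v = 1 ∨ (tpsTree n p s).sub v = 2 ∨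
      (tpsTree n p s).sub v = 3 ∨ (tpsTree n p s).sub v = 3 * α + 1 := by
  rw [sub_tpsTree v hv]
  rcases tpsSub_cases h v hv with ⟨i, -, h2⟩ | h2 <;> omega

end

/-- Two finite families with the same fibre cardinalities differ by a permutation. -/
theorem exists_perm_comp_eq {ι β : Type} [Fintype ι] [DecidableEq β] {f g : ι → β}
    (h : ∀ b, (Finset.univ.filter fun i => f i = b).card =
      (Finset.univ.filter fun i => g i = b).card) :
    ∃ σ : Equiv.Perm ι, g ∘ σ = f := by
  have e : ∀ b, Nonempty ({i // f i = b} ≃ {i // g i = b}) := fun b =>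
    Fintype.card_eq.1 (by rw [Fintype.card_subtype, Fintype.card_subtype, h])
  replace e := fun b => (e b).some
  refine ⟨(Equiv.sigmaFiberEquiv f).symm.trans
    ((Equiv.sigmaCongrRight e).trans (Equiv.sigmaFiberEquiv g)), ?_⟩
  ext i
  exact (e (f i) ⟨i, rfl⟩).2

/-- A triangular system of power-sum-like equalities determines a family of bounded natural
numbers up to a permutation. -/
theorem exists_perm_of_sum_eq {n α : ℕ} {p p' : Fin n → ℕ} (hp : ∀ i, p i ≤ α)
    (hp' : ∀ i, p' i ≤ α)
    (H : ∀ k ≤ α, ∃ w : ℕ → ℤ, (∀ q < k, w q = 0) ∧ w k ≠ 0 ∧ ∑ i, w (p i) = ∑ i, w (p' i)) :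
    ∃ σ : Equiv.Perm (Fin n), p' ∘ σ = p := by
  set c : (Fin n → ℕ) → ℕ → ℤ := fun f k => ((Finset.univ.filter fun i => f i = k).card : ℤ) with hc
  have hsum : ∀ f : Fin n → ℕ, (∀ i, f i ≤ α) → ∀ w : ℕ → ℤ,
      ∑ i, w (f i) = ∑ k ∈ Finset.range (α + 1), c f k * w k := by
    intro f hf w
    rw [← Finset.sum_fiberwise_of_maps_to' (t := Finset.range (α + 1)) (g := f)
      (fun i _ => Finset.mem_range.2 (Nat.lt_succ_of_le (hf i)))]
    refine Finset.sum_congr rfl fun k _ => ?_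
    rw [Finset.sum_const, nsmul_eq_mul]
  have hbig : ∀ f : Fin n → ℕ, (∀ i, f i ≤ α) → ∀ k, α < k → c f k = 0 := by
    intro f hf k hk
    simp only [hc, Nat.cast_eq_zero, Finset.card_eq_zero, Finset.filter_eq_empty_iff]
    intro i _ h
    have := hf i
    omega
  have key : ∀ d k, α ≤ k + d → c p k = c p' k := by
    intro d
    induction d using Nat.strong_induction_on with
    | _ d ih =>
      intro k hk
      rcases Nat.lt_or_ge α k with hlt | hle
      · rw [hbig p hp k hlt, hbig p' hp' k hlt]
      · obtain ⟨w, hw0, hwk, hw⟩ := H k hle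
        rw [hsum p hp, hsum p' hp', ← sub_eq_zero, ← Finset.sum_sub_distrib,
          Finset.sum_eq_single k] at hw
        · rw [← sub_mul, mul_eq_zero, or_iff_left hwk, sub_eq_zero] at hw
          exact hw
        · intro q hq hqk
          rcases Nat.lt_or_gt_of_ne hqk with h | h
          · rw [hw0 q h, mul_zero, mul_zero, sub_zero]
          · rw [Finset.mem_range] at hq
            rw [ih (α - q) (by omega) q (by omega), sub_self]
        · intro h
          exact absurd (Finset.mem_range.2 (Nat.lt_succ_of_le hle)) h
  refine exists_perm_comp_eq fun k => ?_
  exact Nat.cast_injective (R := ℤ) (key α k (by omega))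

namespace ParentTree

variable {V : Type} [Fintype V] [DecidableEq V] {R : ParentTree V} {S : Finset V}

theorem card_fiber_add_sub_le (hS : R.root ∈ S) {a b : V} (hb : b ∈ S) (hab : R.Desc a b)
    (hne : a ≠ b) :
    (Finset.univ.filter fun v => R.top S v = a).card + R.sub b ≤ R.sub a := by
  rw [sub, sub, ← Finset.card_union_of_disjoint]
  · refine Finset.card_le_card fun v hv => ?_
    simp only [Finset.mem_union, Finset.mem_filter, Finset.mem_univ, true_and] at hv ⊢
    rcases hv with rfl | hv
    · exact R.desc_top hS v
    · exact hab.trans hv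
  · refine Finset.disjoint_left.2 fun v hv hv' => hne ?_
    simp only [Finset.mem_filter, Finset.mem_univ, true_and] at hv hv'
    have h := hv'.desc_top hS hb
    rw [hv] at h
    exact hab.depth_le.2 (le_antisymm hab.depth_le.1 h.depth_le.1)

theorem sizes_eq_cons (hS : R.root ∈ S) : R.sizes S =
    (Finset.univ.filter fun v => R.top S v = R.root).card ::ₘ
      (S.erase R.root).val.map fun a => (Finset.univ.filter fun v => R.top S v = a).card := by
  conv_lhs => rw [sizes, ← Finset.insert_erase hS,
    Finset.insert_val_of_notMem (Finset.notMem_erase _ _), Multiset.map_cons,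
    Finset.insert_erase hS]

end ParentTree

theorem le_of_branchTree_sizes {q s k r : ℕ} (hr : 4 ≤ r) {S : Finset (BranchVtx q s)}
    (hS : (branchTree q s).root ∈ S)
    (h : (branchTree q s).sizes S = r ::ₘ Multiset.replicate k 2) : k ≤ q := by
  set Q := branchTree q s with hQ
  have hsmall : ∀ a, a ≠ Q.root → branchSub a ≤ 3 := by
    rintro (_ | ⟨j, l⟩ | ⟨j, l⟩) ha
    · exact absurd rfl ha
    · simp [branchSub]
    · fin_cases l <;> simp [branchSub]
  have hfiber : ∀ a, (Finset.univ.filter fun v => Q.top S v = a).card ≤ branchSub a := fun a =>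
    (Q.card_fiber_le_sub hS a).trans_eq (sub_branchTree a)
  have hroot : (Finset.univ.filter fun v => Q.top S v = Q.root).card = r := by
    obtain ⟨a, -, ha⟩ := Multiset.mem_map.1 (h ▸ Multiset.mem_cons_self _ _ : r ∈ Q.sizes S)
    by_cases hne : a = Q.root
    · exact hne ▸ ha
    · have := hsmall a hne
      have := hfiber a
      omega
  rw [ParentTree.sizes_eq_cons hS, hroot, Multiset.cons_inj_right] at h
  have htwo : ∀ a ∈ S.erase Q.root, (Finset.univ.filter fun v => Q.top S v = a).card = 2 := by
    intro a ha
    exact Multiset.eq_of_mem_replicate (h ▸ Multiset.mem_map_of_mem _ ha)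
  have hcard : (S.erase Q.root).card = k := by
    have := congrArg Multiset.card h
    rwa [Multiset.card_map, Multiset.card_replicate] at this
  have hleaf : ∀ a, branchSub a < 2 → a ∉ S := by
    intro a ha haS
    have h1 := hfiber a
    rw [htwo a] at h1
    · omega
    · refine Finset.mem_erase.2 ⟨?_, haS⟩
      rintro rfl
      have := hfiber Q.root
      omega
  have hfull : ∀ a b c, b ≠ c → a ≠ b → a ≠ c → Q.top S a = a → Q.top S b = a → Q.top S c = a →
      2 < (Finset.univ.filter fun v => Q.top S v = a).card := by
    intro a b c hbc hab hac ha hb hc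
    rw [Finset.two_lt_card]
    exact ⟨a, by simpa using ha, b, by simpa using hb, c, by simpa using hc, hab, hac, hbc⟩
  have hpath : ∀ a ∈ S.erase Q.root, ∃ j, a = Sum.inr (Sum.inl (j, 1)) := by
    intro a ha
    have hatwo := htwo a ha
    obtain ⟨hane, haS⟩ := Finset.mem_erase.1 ha
    rcases a with (_ | ⟨j, l⟩ | ⟨j, l⟩)
    · exact absurd rfl hane
    · fin_cases l
      · exfalso
        by_cases h1 : Sum.inr (Sum.inl (j, 1)) ∈ S
        · have := ParentTree.card_fiber_add_sub_le (R := Q) hS h1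
            (a := Sum.inr (Sum.inl (j, 0))) ⟨1, rfl⟩ (by simp)
          rw [sub_branchTree, sub_branchTree] at this
          simp only [branchSub, Fin.isValue, Fin.val_one, Fin.val_zero] at this
          exact absurd hatwo (by simp only [Fin.zero_eta, Fin.isValue]; omega)
        · have h2 := hleaf (Sum.inr (Sum.inl (j, 2))) (by simp [branchSub])
          have ht0 := Q.top_of_mem haS
          have ht1 := (Q.top_of_notMem hS h1).trans ht0
          have ht2 := (Q.top_of_notMem hS h2).trans ht1
          exact (hfull _ _ _ (by simp) (by simp) (by simp) ht0 ht1 ht2).ne' hatwo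
      · exact ⟨j, rfl⟩
      · exact absurd haS (hleaf _ (by simp [branchSub]))
    · exfalso
      fin_cases l
      · have h1 := hleaf (Sum.inr (Sum.inr (j, 1))) (by simp [branchSub])
        have h2 := hleaf (Sum.inr (Sum.inr (j, 2))) (by simp [branchSub])
        have ht0 := Q.top_of_mem haS
        have ht1 := (Q.top_of_notMem hS h1).trans ht0
        have ht2 := (Q.top_of_notMem hS h2).trans ht0
        exact (hfull _ _ _ (by simp) (by simp) (by simp) ht0 ht1 ht2).ne' hatwo
      · exact hleaf _ (by simp [branchSub]) haS
      · exact hleaf _ (by simp [branchSub]) haS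
  have hsub : S.erase Q.root ⊆
      Finset.univ.image fun j : Fin q => (Sum.inr (Sum.inl (j, 1)) : BranchVtx q s) := by
    intro a ha
    obtain ⟨j, rfl⟩ := hpath a ha
    exact Finset.mem_image_of_mem _ (Finset.mem_univ _)
  calc k = (S.erase Q.root).card := hcard.symm
    _ ≤ _ := Finset.card_le_card hsub
    _ ≤ _ := Finset.card_image_le
    _ = q := by simp

theorem exists_branchTree_sizes (k s : ℕ) : ∃ S, (branchTree k s).root ∈ S ∧
    (branchTree k s).sizes S = (3 * (k + s) + 1 - 2 * k) ::ₘ Multiset.replicate k 2 := by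
  set Q := branchTree k s with hQ
  set D : Finset (BranchVtx k s) := Finset.univ.image fun j : Fin k => Sum.inr (Sum.inl (j, 1))
  have hD : D.card = k := by
    rw [Finset.card_image_of_injective _ (fun i j h => by simpa using h)]
    simp
  have hroot : Q.root ∉ D := by
    intro h
    obtain ⟨j, -, hj⟩ := Finset.mem_image.1 h
    cases hj
  have hS : Q.root ∈ insert Q.root D := Finset.mem_insert_self _ _
  refine ⟨insert Q.root D, hS, ?_⟩
  have htwo : ∀ a ∈ D, (Finset.univ.filter fun v => Q.top (insert Q.root D) v = a).card = 2 := by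
    intro a ha
    have haS := Finset.mem_insert_of_mem (b := Q.root) ha
    obtain ⟨j, -, rfl⟩ := Finset.mem_image.1 ha
    refine le_antisymm ?_ ?_
    · refine (Q.card_fiber_le_sub hS _).trans_eq (sub_branchTree _)
    · have h2 : (Sum.inr (Sum.inl (j, 2)) : BranchVtx k s) ∉ insert Q.root D := by
        simp [D, hQ, branchTree]
      have ht1 := Q.top_of_mem haS
      have ht2 := (Q.top_of_notMem hS h2).trans ht1
      refine Finset.one_lt_card.2 ⟨Sum.inr (Sum.inl (j, 1)), by simpa using ht1,
        Sum.inr (Sum.inl (j, 2)), by simpa using ht2, by simp⟩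
  have hmap : ((insert Q.root D).erase Q.root).val.map
      (fun a => (Finset.univ.filter fun v => Q.top (insert Q.root D) v = a).card) =
        Multiset.replicate k 2 := by
    rw [Finset.erase_insert hroot, Multiset.map_congr rfl htwo, Multiset.map_const',
      Finset.card_val,
      hD]
  have hsum := Q.sum_sizes hS
  rw [ParentTree.sizes_eq_cons hS, hmap] at hsum ⊢
  rw [Multiset.sum_cons, Multiset.sum_replicate, card_branchVtx, smul_eq_mul] at hsum
  congr 1
  omega

theorem perm_of_UPoly_eq {n α : ℕ} (hn : 2 ≤ n) (hα : 0 < α) {p p' : Fin n → ℕ}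
    (hp : ∀ i, p i ≤ α) (hp' : ∀ i, p' i ≤ α) (h : UPoly (Ttree α p) = UPoly (Ttree α p')) :
    ∃ σ : Equiv.Perm (Fin n), p' ∘ σ = p := by
  have hs : ∀ i, p i + (α - p i) = α := fun i => Nat.add_sub_cancel' (hp i)
  have hs' : ∀ i, p' i + (α - p' i) = α := fun i => Nat.add_sub_cancel' (hp' i)
  have hcard : Fintype.card (Vtx n p fun i => α - p i) =
      Fintype.card (Vtx n p' fun i => α - p' i) := by
    rw [card_vtx hs, card_vtx hs']
  have hN : 4 ≤ Fintype.card (Vtx n p fun i => α - p i) := by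
    have : 2 * (3 * α + 1) ≤ n * (3 * α + 1) := Nat.mul_le_mul_right _ hn
    rw [card_vtx hs]
    omega
  have hsum : ∑ i, p i = ∑ i, p' i := by
    rw [← card_sub_tpsTree_two hn hα hs, ← card_sub_tpsTree_two hn hα hs',
      ← (tpsTree_isRootingOf _ _ _).count_pair (two_mul_sub_tpsTree_le hn hα hs) hN,
      ← (tpsTree_isRootingOf _ _ _).count_pair (two_mul_sub_tpsTree_le hn hα hs') (hcard ▸ hN),
      ← hcard]
    exact congrArg _ h
  have hcons : ∀ (l : Multiset ℕ) (r : ℕ), 4 ≤ r → r ∈ l →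
      ∑ i, (Finset.univ.filter fun S => (branchTree (p i) (α - p i)).root ∈ S ∧
        (branchTree (p i) (α - p i)).sizes S = l).card =
      ∑ i, (Finset.univ.filter fun S => (branchTree (p' i) (α - p' i)).root ∈ S ∧
        (branchTree (p' i) (α - p' i)).sizes S = l).card := by
    intro l r hr hrl
    rw [← count_UPoly_cons hn hα hs hr hrl, ← count_UPoly_cons hn hα hs' hr hrl, ← hcard]
    exact congrArg _ h
  refine exists_perm_of_sum_eq hp hp' fun k hk => ?_
  rcases Nat.eq_zero_or_pos k with rfl | hk0
  · exact ⟨fun _ => 1, by simp, by simp, by simp⟩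
  by_cases hk1 : k = 1
  · subst hk1
    exact ⟨fun q => q, by simp, by simp, by beta_reduce; exact_mod_cast hsum⟩
  by_cases hα2 : α = 2
  · subst hα2
    obtain rfl : k = 2 := by omega
    set W : ℕ → ℕ := fun q => (Finset.univ.filter fun S => (branchTree q (2 - q)).root ∈ S ∧
      (branchTree q (2 - q)).sizes S = {4, 2, 1}).card with hW
    have hW0 : W 0 = 4 := by decide +kernel
    have hW1 : W 1 = 6 := by decide +kernel
    have hW2 : W 2 = 6 := by decide +kernel
    refine ⟨fun q => W q - 4 - 2 * q, ?_, ?_, ?_⟩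
    · intro q hq
      interval_cases q
      · simp [hW0]
      · simp [hW1]
    · simp [hW2]
    · have h1 : ∑ i, W (p i) = ∑ i, W (p' i) := hcons {4, 2, 1} 4 le_rfl (by simp)
      have h1' : ∑ i, (W (p i) : ℤ) = ∑ i, (W (p' i) : ℤ) := by exact_mod_cast h1
      have h2' : ∑ i, (p i : ℤ) = ∑ i, (p' i : ℤ) := by exact_mod_cast hsum
      simp only [Finset.sum_sub_distrib, ← Finset.mul_sum, h1', h2']
  · refine ⟨fun q => ((Finset.univ.filter fun S => (branchTree q (α - q)).root ∈ S ∧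
      (branchTree q (α - q)).sizes S =
        (3 * α + 1 - 2 * k) ::ₘ Multiset.replicate k 2).card : ℕ), ?_, ?_, ?_⟩
    · intro q hq
      simp only [Nat.cast_eq_zero, Finset.card_eq_zero, Finset.filter_eq_empty_iff, not_and]
      intro S _ hS hS'
      have := le_of_branchTree_sizes (by omega) hS hS'
      omega
    · obtain ⟨S, hS, hS'⟩ := exists_branchTree_sizes k (α - k)
      rw [Nat.add_sub_cancel' hk] at hS'
      simp only [ne_eq, Nat.cast_eq_zero, Finset.card_eq_zero]
      exact Finset.Nonempty.ne_empty ⟨S, Finset.mem_filter.2 ⟨Finset.mem_univ _, hS, hS'⟩⟩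
    · beta_reduce
      exact_mod_cast hcons (_ ::ₘ Multiset.replicate k 2) (3 * α + 1 - 2 * k) (by omega)
        (Multiset.mem_cons_self _ _)

/-- A map of rooted trees of the same order that is injective on siblings is an isomorphism. -/
theorem ParentTree.IsRootingOf.nonempty_iso {V W : Type} [Fintype V] [Fintype W]
    {R : ParentTree V} {Q : ParentTree W} {G : SimpleGraph V} {H : SimpleGraph W}
    (hR : R.IsRootingOf G) (hQ : Q.IsRootingOf H) (f : W → V) (hroot : f Q.root = R.root)
    (hchild : ∀ w, w ≠ Q.root → f w ∈ R.children (f (Q.par w)))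
    (hinj : ∀ w w', w ≠ Q.root → w' ≠ Q.root → Q.par w = Q.par w' → f w = f w' → w = w')
    (hcard : Fintype.card W = Fintype.card V) : Nonempty (H ≃g G) := by
  have hne : ∀ w, f w ≠ R.root ↔ w ≠ Q.root := by
    intro w
    refine ⟨?_, fun hw => (mem_children.1 (hchild w hw)).1⟩
    rintro h rfl
    exact h hroot
  have hf : Function.Injective f := by
    intro w
    refine Q.induction (P := fun w => ∀ ⦃w'⦄, f w = f w' → w = w') ?_ ?_ w
    · intro w' h
      by_contra hw'
      exact (hne w').2 (Ne.symm hw') (h ▸ hroot)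
    · intro w hw ih w' h
      have hw' : w' ≠ Q.root := (hne w').1 (h ▸ (hne w).2 hw)
      refine hinj w w' hw hw' (ih ?_) h
      rw [← (mem_children.1 (hchild w hw)).2, ← (mem_children.1 (hchild w' hw')).2, h]
  have hpar : ∀ u v, (f u ≠ R.root ∧ R.par (f u) = f v) ↔ (u ≠ Q.root ∧ Q.par u = v) := by
    intro u v
    rw [hne]
    refine and_congr_right fun hu => ?_
    rw [(mem_children.1 (hchild u hu)).2, hf.eq_iff]
  refine ⟨⟨Equiv.ofBijective f ((Fintype.bijective_iff_injective_and_card f).2 ⟨hf, hcard⟩), ?_⟩⟩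
  intro u v
  rw [hQ, hR]
  exact or_congr (hpar u v) (hpar v u)

/-- The map out of `T(p,s)` given by its values on the centre, on the branch roots, on the paths
and on the stars. -/
def tpsMap {V : Type} {n : ℕ} {p s : Fin n → ℕ} (r : V) (e : Fin n → V)
    (x₀ x₁ x₂ : ∀ i, Fin (p i) → V) (y₀ y₁ y₂ : ∀ i, Fin (s i) → V) : Vtx n p s → V
  | Sum.inl () => r
  | Sum.inr (Sum.inl i) => e i
  | Sum.inr (Sum.inr (Sum.inl ⟨i, j, 0⟩)) => x₀ i j
  | Sum.inr (Sum.inr (Sum.inl ⟨i, j, 1⟩)) => x₁ i j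
  | Sum.inr (Sum.inr (Sum.inl ⟨i, j, 2⟩)) => x₂ i j
  | Sum.inr (Sum.inr (Sum.inr ⟨i, j, 0⟩)) => y₀ i j
  | Sum.inr (Sum.inr (Sum.inr ⟨i, j, 1⟩)) => y₁ i j
  | Sum.inr (Sum.inr (Sum.inr ⟨i, j, 2⟩)) => y₂ i j

theorem ParentTree.IsRootingOf.nonempty_iso_tpsGraph {V : Type} [Fintype V] {R : ParentTree V}
    {G : SimpleGraph V} (hR : R.IsRootingOf G) {n : ℕ} {p s : Fin n → ℕ}
    (hcard : Fintype.card (Vtx n p s) = Fintype.card V) {e : Fin n → V}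
    {x₀ x₁ x₂ : ∀ i, Fin (p i) → V} {y₀ y₁ y₂ : ∀ i, Fin (s i) → V}
    (he : ∀ i, e i ∈ R.children R.root) (hx₀ : ∀ i j, x₀ i j ∈ R.children (e i))
    (hx₁ : ∀ i j, x₁ i j ∈ R.children (x₀ i j)) (hx₂ : ∀ i j, x₂ i j ∈ R.children (x₁ i j))
    (hy₀ : ∀ i j, y₀ i j ∈ R.children (e i)) (hy₁ : ∀ i j, y₁ i j ∈ R.children (y₀ i j))
    (hy₂ : ∀ i j, y₂ i j ∈ R.children (y₀ i j)) (hy : ∀ i j, y₁ i j ≠ y₂ i j)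
    (hei : Function.Injective e) (hxi : ∀ i, Function.Injective (x₀ i))
    (hyi : ∀ i, Function.Injective (y₀ i)) (hxy : ∀ i j j', x₀ i j ≠ y₀ i j') :
    Nonempty (TpsGraph n p s ≃g G) := by
  refine hR.nonempty_iso (tpsTree_isRootingOf n p s) (tpsMap R.root e x₀ x₁ x₂ y₀ y₁ y₂) rfl
    ?_ ?_ hcard
  · rintro (_ | i | ⟨i, j, l⟩ | ⟨i, j, l⟩) h
    · exact absurd rfl h
    · exact he i
    · fin_cases l
      exacts [hx₀ i j, hx₁ i j, hx₂ i j]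
    · fin_cases l
      exacts [hy₀ i j, hy₁ i j, hy₂ i j]
  · rintro (_ | i | ⟨i, j, l⟩ | ⟨i, j, l⟩) (_ | i' | ⟨i', j', l'⟩ | ⟨i', j', l'⟩) hw hw' hpar h
    all_goals first | exact absurd rfl hw | exact absurd rfl hw' | skip
    · rw [hei h]
    · fin_cases l' <;> cases hpar
    · fin_cases l' <;> cases hpar
    · fin_cases l <;> cases hpar
    · fin_cases l <;> fin_cases l' <;> cases hpar
      · rw [hxi i h]
      · rfl
      · rfl
    · fin_cases l <;> fin_cases l' <;> cases hpar
      exact absurd h (hxy i j j')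
    · fin_cases l <;> cases hpar
    · fin_cases l <;> fin_cases l' <;> cases hpar
      exact absurd h.symm (hxy i j' j)
    · fin_cases l <;> fin_cases l' <;> cases hpar
      · rw [hyi i h]
      · rfl
      · exact absurd h (hy i j)
      · exact absurd h.symm (hy i j)
      · rfl

namespace ParentTree

variable {V : Type} [Fintype V] {R : ParentTree V}

theorem children_nonempty {v : V} (hv : 1 < R.sub v) : (R.children v).Nonempty := by
  by_contra h
  rw [R.sub_eq, Finset.not_nonempty_iff_eq_empty.1 h, Finset.sum_empty] at hv
  omega

theorem exists_path_or_exists_star {v : V} (hv : R.sub v = 3) :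
    (∃ a ∈ R.children v, ∃ b, b ∈ R.children a) ∨
      ∃ a ∈ R.children v, ∃ b ∈ R.children v, a ≠ b := by
  obtain ⟨a, ha⟩ := children_nonempty (R := R) (v := v) (by omega)
  by_cases h : ∃ b ∈ R.children v, a ≠ b
  · exact Or.inr ⟨a, ha, h⟩
  · push Not at h
    have hsingle : R.children v = {a} :=
      Finset.eq_singleton_iff_unique_mem.2 ⟨ha, fun b hb => (h b hb).symm⟩
    rw [R.sub_eq, hsingle, Finset.sum_singleton] at hv
    exact Or.inl ⟨a, ha, children_nonempty (by omega)⟩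

/-- A balanced tree with the same numbers of subtrees of each order as `T_α(p)` is some `T_α(p')`,
and the entries of `p'` may be listed in any order. -/
theorem IsRootingOf.exists_iso_Ttree {G : SimpleGraph V} (hR : R.IsRootingOf G) {n α : ℕ}
    (hn : 2 ≤ n) (hα : 0 < α) (hV : Fintype.card V = 1 + n * (3 * α + 1))
    (hsub : ∀ v, v ≠ R.root → R.sub v = 1 ∨ R.sub v = 2 ∨ R.sub v = 3 ∨ R.sub v = 3 * α + 1)
    (hbranch : (Finset.univ.filter fun v => R.sub v = 3 * α + 1).card = n)
    (hthree : (Finset.univ.filter fun v => R.sub v = 3).card = n * α) :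
    ∃ p : Fin n → ℕ, (∀ i, p i ≤ α) ∧
      ∀ σ : Equiv.Perm (Fin n), Nonempty (Ttree α (p ∘ σ) ≃g G) := by
  set M : Finset V := Finset.univ.filter fun v => R.sub v = 3 * α + 1 with hM
  have memM : ∀ v, v ∈ M ↔ R.sub v = 3 * α + 1 := fun v => by simp [hM]
  have hrootsub : 3 * α + 1 < R.sub R.root := by
    have : 2 * (3 * α + 1) ≤ n * (3 * α + 1) := Nat.mul_le_mul_right _ hn
    rw [R.sub_root, hV]
    omega
  have hMchild : M ⊆ R.children R.root := by
    intro v hv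
    rw [memM] at hv
    have hne : v ≠ R.root := by
      rintro rfl
      omega
    refine mem_children.2 ⟨hne, ?_⟩
    by_contra hpar
    have h1 := R.sub_lt_sub_par hne
    have h2 := hsub _ hpar
    omega
  have hchild : R.children R.root = M := by
    refine (Finset.eq_of_subset_of_card_le hMchild ?_).symm
    have h1 := R.sub_eq R.root
    rw [R.sub_root, hV, ← Finset.sum_sdiff hMchild,
      Finset.sum_congr (s₁ := M) rfl fun v hv => (memM v).1 hv, Finset.sum_const, hbranch,
      smul_eq_mul] at h1
    have h2 : (R.children R.root \ M).card • 1 ≤ ∑ v ∈ R.children R.root \ M, R.sub v :=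
      Finset.card_nsmul_le_sum _ _ _ fun v _ => R.one_le_sub v
    have h3 := Finset.card_sdiff_add_card_eq_card hMchild
    rw [smul_eq_mul] at h2
    omega
  set K : V → Finset V := fun a => (R.children a).filter fun v => R.sub v = 3 with hK
  have hKle : ∀ a ∈ M, (K a).card ≤ α := by
    intro a ha
    rw [memM, R.sub_eq] at ha
    have h1 : ∑ v ∈ K a, R.sub v ≤ ∑ v ∈ R.children a, R.sub v :=
      Finset.sum_le_sum_of_subset (Finset.filter_subset _ _)
    rw [Finset.sum_congr (s₁ := K a) rfl fun v hv => (Finset.mem_filter.1 hv).2,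
      Finset.sum_const, smul_eq_mul] at h1
    omega
  have hKsum : ∑ a ∈ M, (K a).card = ∑ a ∈ M, α := by
    rw [Finset.sum_const, hbranch, smul_eq_mul, ← hthree]
    rw [Finset.card_eq_sum_card_fiberwise (f := R.par) (t := M)]
    · refine Finset.sum_congr rfl fun a _ => congrArg _ ?_
      ext v
      simp only [hK, Finset.mem_filter, mem_children, Finset.mem_univ, true_and]
      constructor
      · exact fun h => ⟨h.2, h.1.2⟩
      · refine fun h => ⟨⟨?_, h.2⟩, h.1⟩
        rintro rfl
        omega
    · intro v hv
      have hv : R.sub v = 3 := by simpa using hv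
      have hne : v ≠ R.root := by
        rintro rfl
        omega
      have hpar : R.par v ≠ R.root := by
        intro h
        have := (memM v).1 (hchild ▸ mem_children.2 ⟨hne, h⟩)
        omega
      have h1 := R.sub_lt_sub_par hne
      have h2 := hsub _ hpar
      rw [Finset.mem_coe, memM]
      omega
  have hKcard : ∀ a ∈ M, (K a).card = α := (Finset.sum_eq_sum_iff_of_le hKle).1 hKsum
  set P : V → Prop := fun v => ∃ a ∈ R.children v, ∃ b, b ∈ R.children a with hP
  have hPcard : ∀ a ∈ M, ((K a).filter P).card + ((K a).filter fun v => ¬ P v).card = α :=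
    fun a ha => (Finset.card_filter_add_card_filter_not P).trans (hKcard a ha)
  have hstar : ∀ v, R.sub v = 3 → ¬ P v → ∃ a ∈ R.children v, ∃ b ∈ R.children v, a ≠ b :=
    fun v hv hPv => (exists_path_or_exists_star hv).resolve_left hPv
  choose! c hc d hd using (fun v (h : P v) => h)
  choose! c' hc' d' hd' hcd using hstar
  let e₀ : Fin n ≃ M := (M.equivFinOfCardEq hbranch).symm
  refine ⟨fun i => ((K (e₀ i)).filter P).card, fun i => ?_, fun σ => ?_⟩
  · have := hPcard _ (e₀ i).2
    beta_reduce
    omega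
  have ex : ∀ i : Fin n, Nonempty (Fin ((K (e₀ (σ i))).filter P).card ≃ (K (e₀ (σ i))).filter P) :=
    fun i => ⟨(Finset.equivFin _).symm⟩
  have ey : ∀ i : Fin n, Nonempty (Fin (α - ((K (e₀ (σ i))).filter P).card) ≃
      (K (e₀ (σ i))).filter fun v => ¬ P v) := fun i => by
    refine ⟨(Finset.equivFinOfCardEq ?_).symm⟩
    have := hPcard _ (e₀ (σ i)).2
    omega
  replace ex := fun i => (ex i).some
  replace ey := fun i => (ey i).some
  have hx : ∀ i j, ((ex i j : V) ∈ R.children (e₀ (σ i)) ∧ R.sub (ex i j) = 3) ∧ P (ex i j) := by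
    intro i j
    simpa only [hK, Finset.mem_filter] using (ex i j).2
  have hy : ∀ i j, ((ey i j : V) ∈ R.children (e₀ (σ i)) ∧ R.sub (ey i j) = 3) ∧ ¬ P (ey i j) := by
    intro i j
    simpa only [hK, Finset.mem_filter] using (ey i j).2
  refine hR.nonempty_iso_tpsGraph (e := fun i => e₀ (σ i)) (x₀ := fun i j => ex i j)
    (x₁ := fun i j => c (ex i j)) (x₂ := fun i j => d (ex i j)) (y₀ := fun i j => ey i j)
    (y₁ := fun i j => c' (ey i j)) (y₂ := fun i j => d' (ey i j)) ?_ ?_ ?_ ?_ ?_ ?_ ?_ ?_ ?_ ?_ ?_ ?_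
    ?_
  · rw [hV]
    refine card_vtx fun i => Nat.add_sub_cancel' ?_
    have := hPcard _ (e₀ (σ i)).2
    simp only [Function.comp_apply]
    omega
  · exact fun i => hMchild (e₀ (σ i)).2
  · exact fun i j => (hx i j).1.1
  · exact fun i j => hc _ (hx i j).2
  · exact fun i j => hd _ (hx i j).2
  · exact fun i j => (hy i j).1.1
  · exact fun i j => hc' _ (hy i j).1.2 (hy i j).2
  · exact fun i j => hd' _ (hy i j).1.2 (hy i j).2
  · exact fun i j => hcd _ (hy i j).1.2 (hy i j).2
  · exact Subtype.val_injective.comp (e₀.injective.comp σ.injective)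
  · exact fun i => Subtype.val_injective.comp (ex i).injective
  · exact fun i => Subtype.val_injective.comp (ey i).injective
  · exact fun i j j' h => (hy i j').2 (h ▸ (hx i j).2)

end ParentTree

theorem exists_iso_Ttree_of_UPoly_eq {V : Type} [Fintype V] {G : SimpleGraph V} (hG : G.IsTree)
    {n α : ℕ} (hn : 2 ≤ n) (hα : 0 < α) {p : Fin n → ℕ} (hp : ∀ i, p i ≤ α)
    (h : UPoly (Ttree α p) = UPoly G) :
    ∃ p' : Fin n → ℕ, (∀ i, p' i ≤ α) ∧
      ∀ σ : Equiv.Perm (Fin n), Nonempty (Ttree α (p' ∘ σ) ≃g G) := by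
  obtain ⟨R, hR, hbal⟩ := exists_balanced_rooting hG
  have hs : ∀ i, p i + (α - p i) = α := fun i => Nat.add_sub_cancel' (hp i)
  have hT := tpsTree_isRootingOf n p fun i => α - p i
  have hTbal := two_mul_sub_tpsTree_le hn hα hs
  have h : UPoly (TpsGraph n p fun i => α - p i) = UPoly G := h
  have hcard : Fintype.card (Vtx n p fun i => α - p i) = Fintype.card V := by
    obtain ⟨l, hl⟩ := Multiset.exists_mem_of_ne_zero hR.UPoly_ne_zero
    rw [← hR.sum_eq_card hl, ← hT.sum_eq_card (h ▸ hl)]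
  have hV : Fintype.card V = 1 + n * (3 * α + 1) := hcard ▸ card_vtx hs
  have hcount : ∀ s, 2 * s ≤ Fintype.card V →
      (Finset.univ.filter fun v => R.sub v = s).card =
        (Finset.univ.filter fun v => (tpsTree n p fun i => α - p i).sub v = s).card := by
    intro s hs2
    rw [← hR.count_pair hbal hs2, ← hT.count_pair hTbal (hcard ▸ hs2), hcard, h]
  have hm : 2 * (3 * α + 1) ≤ n * (3 * α + 1) := Nat.mul_le_mul_right _ hn
  refine hR.exists_iso_Ttree hn hα hV ?_ ?_ ?_
  · intro v hv
    have hpos : 0 < (Finset.univ.filter fun w => R.sub w = R.sub v).card :=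
      Finset.card_pos.2 ⟨v, by simp⟩
    rw [hcount _ (hbal v hv)] at hpos
    obtain ⟨w, hw⟩ := Finset.card_pos.1 hpos
    have hw : (tpsTree n p fun i => α - p i).sub w = R.sub v := by simpa using hw
    rw [← hw]
    refine sub_tpsTree_cases hs w ?_
    rintro rfl
    have := hbal v hv
    rw [ParentTree.sub_root] at hw
    omega
  · rw [hcount _ (by omega), card_sub_tpsTree_branch hn hα hs]
  · rw [hcount _ (by omega), card_sub_tpsTree_three hn hα hs]

/-- PTE-trees are distinguished up to isomorphism among all trees by the
`U`-polynomial: if `T` is a PTE-tree and `T'` is any tree with `U(T) = U(T')`,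
then `T'` is isomorphic to `T`. -/
theorem U_distinguishes_PTE_trees {V V' : Type} [Fintype V] [Fintype V']
    (G : SimpleGraph V) (G' : SimpleGraph V')
    (hG : IsPTETree G) (hG' : G'.IsTree)
    (h : UPoly G = UPoly G') : Nonempty (G' ≃g G) := by
  obtain ⟨n, α, p, hα, ⟨hn, hp⟩, ⟨f⟩⟩ := hG
  have hp_eq : UPoly (Ttree α p) = UPoly G' := (UPoly_congr f).symm.trans h
  obtain ⟨p', hp', hiso⟩ := exists_iso_Ttree_of_UPoly_eq hG' hn hα hp hp_eq
  obtain ⟨g⟩ := hiso (Equiv.refl _)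
  obtain ⟨σ, rfl⟩ := perm_of_UPoly_eq hn hα hp hp' (hp_eq.trans (UPoly_congr g).symm)
  obtain ⟨g'⟩ := hiso σ
  exact ⟨g'.symm.trans f.symm⟩
end

section
/- Let T = (V,E) be a tree and let S = (W,F) be a subtree of T. Then for every A ⊆ F, the partition λ_T(E∖A) of |V| induced by A in T equals the partition λ_{S_{ω,T}}(F∖A) induced by A in the contracted weighted tree S_{ω,T}. Consequently, U_F(T) = W(S_{ω,T}), i.e. the partial U-polynomial of T over subsets of F equals the W-polynomial of the contraction of S in T. -/
open scoped Classical

/-- The partial `U`-polynomial `U_F(T) = Σ_{A ⊆ F} x_{λ(E∖A)}`, encoded as the multiset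
of partitions `λ(E∖A)` over all subsets `A` of `F`. -/
noncomputable def UFPoly {V : Type} [Fintype V] (G : SimpleGraph V) (F : Finset (Sym2 V)) :
    Multiset (Multiset ℕ) :=
  F.powerset.val.map fun A => componentSizes (G.deleteEdges ↑A)

/-- Vertices of the contraction `S_{ω,T}`: when all edges outside `F` are contracted,
the vertices are the connected components of the spanning subgraph `(V, E∖F)`. -/
abbrev ContVtx {V : Type} (G : SimpleGraph V) (F : Set (Sym2 V)) : Type :=
  (G.deleteEdges F).ConnectedComponent

/-- The contraction of `G` along all edges outside `F`: two contracted vertices are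
adjacent if they are joined by an edge of `G` belonging to `F`. -/
def contractGraph {V : Type} (G : SimpleGraph V) (F : Set (Sym2 V)) :
    SimpleGraph (ContVtx G F) :=
  SimpleGraph.fromRel fun c c' => ∃ u v : V, G.Adj u v ∧ s(u, v) ∈ F ∧
    (G.deleteEdges F).connectedComponentMk u = c ∧
    (G.deleteEdges F).connectedComponentMk v = c'

/-- The weight of a contracted vertex: the number of original (weight-one) vertices
collapsed to it. -/
noncomputable def contractWeight {V : Type} [Fintype V] (G : SimpleGraph V)
    (F : Set (Sym2 V)) : ContVtx G F → ℕ :=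
  fun c => Nat.card c.supp

/-- The image of an edge of `G` in the contraction. -/
def contractEdge {V : Type} (G : SimpleGraph V) (F : Set (Sym2 V)) :
    Sym2 V → Sym2 (ContVtx G F) :=
  Sym2.map (G.deleteEdges F).connectedComponentMk

/-- The multiset of total weights of the connected components of a weighted graph. -/
noncomputable def wComponentSizes {Q : Type} [Fintype Q] (H : SimpleGraph Q) (w : Q → ℕ) :
    Multiset ℕ :=
  (Finset.univ : Finset H.ConnectedComponent).val.map fun c => ∑ v ∈ c.supp.toFinset, w v

/-- The `W`-polynomial of a weighted graph, encoded as the multiset of weighted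
partitions `λ(E∖A)` over all edge subsets `A`. -/
noncomputable def WPoly {Q : Type} [Fintype Q] (H : SimpleGraph Q) (w : Q → ℕ) :
    Multiset (Multiset ℕ) :=
  H.edgeFinset.powerset.val.map fun A => wComponentSizes (H.deleteEdges ↑A) w

/-- If `q : V → Q` is surjective and induces a bijection on connected components, the component
sizes upstairs are the component weights downstairs for the fiber-size weight. -/
theorem componentSizes_eq_wComponentSizes {V Q : Type} [Fintype V] [Fintype Q]
    {H : SimpleGraph V} {K : SimpleGraph Q} {q : V → Q} (hq : q.Surjective)
    (h : ∀ u v, K.Reachable (q u) (q v) ↔ H.Reachable u v) {w : Q → ℕ}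
    (hw : ∀ c, w c = Nat.card (q ⁻¹' {c})) :
    componentSizes H = wComponentSizes K w := by
  refine Multiset.map_eq_map_of_bij_of_nodup _ _ (Finset.nodup _) (Finset.nodup _)
    (fun c _ => c.lift (fun v => K.connectedComponentMk (q v)) fun u v p _ =>
      SimpleGraph.ConnectedComponent.sound ((h u v).2 p.reachable))
    (fun _ _ => Finset.mem_univ _) ?_ ?_ ?_
  · refine SimpleGraph.ConnectedComponent.ind fun u _ => ?_
    refine SimpleGraph.ConnectedComponent.ind fun v _ huv => ?_
    exact SimpleGraph.ConnectedComponent.sound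
      ((h u v).1 (SimpleGraph.ConnectedComponent.exact huv))
  · refine SimpleGraph.ConnectedComponent.ind fun c _ => ?_
    obtain ⟨v, rfl⟩ := hq c
    exact ⟨H.connectedComponentMk v, Finset.mem_univ _, rfl⟩
  · refine SimpleGraph.ConnectedComponent.ind fun u _ => ?_
    rw [SimpleGraph.ConnectedComponent.lift_mk, Nat.card_eq_card_toFinset,
      Finset.card_eq_sum_card_fiberwise
        (f := q) (t := (K.connectedComponentMk (q u)).supp.toFinset)]
    · refine Finset.sum_congr rfl fun c hc => ?_
      rw [hw, Nat.card_eq_card_toFinset]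
      congr 1
      ext v
      simp only [Finset.mem_filter, Set.mem_toFinset, Set.mem_preimage, Set.mem_singleton_iff,
        SimpleGraph.ConnectedComponent.mem_supp_iff, SimpleGraph.ConnectedComponent.eq] at hc ⊢
      refine ⟨And.right, fun hv => ⟨?_, hv⟩⟩
      rw [← h, hv]
      exact hc
    · intro v hv
      simpa [h] using hv

/-- In an acyclic graph, the ends of an edge of `F` are separated by deleting `F`. -/
theorem SimpleGraph.IsAcyclic.not_reachable_deleteEdges {V : Type} {G : SimpleGraph V}
    (hG : G.IsAcyclic) {F : Set (Sym2 V)} {u v : V} (huv : G.Adj u v) (hF : s(u, v) ∈ F) :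
    ¬ (G.deleteEdges F).Reachable u v := fun h =>
  SimpleGraph.isAcyclic_iff_forall_adj_isBridge.1 hG huv
    (h.mono (SimpleGraph.deleteEdges_anti (Set.singleton_subset_iff.2 hF)))

/-- In an acyclic graph, an edge of `F` is determined by the components of the graph without `F`
that it joins. -/
theorem SimpleGraph.IsAcyclic.edge_eq_of_reachable_deleteEdges {V : Type} {G : SimpleGraph V}
    (hG : G.IsAcyclic) {F : Set (Sym2 V)} {u v u' v' : V} (huv : G.Adj u v) (hF : s(u, v) ∈ F)
    (huv' : G.Adj u' v') (hu : (G.deleteEdges F).Reachable u u')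
    (hv : (G.deleteEdges F).Reachable v v') : s(u', v') = s(u, v) := by
  by_contra hne
  have hle : G.deleteEdges F ≤ G.deleteEdges {s(u, v)} :=
    SimpleGraph.deleteEdges_anti (Set.singleton_subset_iff.2 hF)
  have hadj : (G.deleteEdges {s(u, v)}).Adj u' v' := by
    simpa only [SimpleGraph.deleteEdges_adj, Set.mem_singleton_iff] using ⟨huv', hne⟩
  exact SimpleGraph.isAcyclic_iff_forall_adj_isBridge.1 hG huv
    (((hu.mono hle).trans hadj.reachable).trans (hv.mono hle).symm)

theorem contractEdge_injOn {V : Type} {G : SimpleGraph V} (hG : G.IsAcyclic) {F : Set (Sym2 V)}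
    (hF : F ⊆ G.edgeSet) : Set.InjOn (contractEdge G F) F := by
  intro e he e' he' h
  induction e with | h u v =>
  induction e' with | h u' v' =>
  simp only [contractEdge, Sym2.map_mk, Sym2.eq_iff, SimpleGraph.ConnectedComponent.eq] at h
  obtain ⟨hu, hv⟩ | ⟨hu, hv⟩ := h
  · exact (hG.edge_eq_of_reachable_deleteEdges (hF he) he (hF he') hu hv).symm
  · rw [Sym2.eq_swap (a := u') (b := v')]
    exact (hG.edge_eq_of_reachable_deleteEdges (hF he) he (hF he').symm hu hv).symm

theorem contractGraph_adj {V : Type} {G : SimpleGraph V} (hG : G.IsAcyclic) {F : Set (Sym2 V)}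
    {c c' : ContVtx G F} : (contractGraph G F).Adj c c' ↔
      ∃ u v : V, G.Adj u v ∧ s(u, v) ∈ F ∧ (G.deleteEdges F).connectedComponentMk u = c ∧
        (G.deleteEdges F).connectedComponentMk v = c' := by
  rw [contractGraph, SimpleGraph.fromRel_adj]
  constructor
  · rintro ⟨-, h | ⟨u, v, huv, hF, hu, hv⟩⟩
    · exact h
    · exact ⟨v, u, huv.symm, Sym2.eq_swap ▸ hF, hv, hu⟩
  · rintro ⟨u, v, huv, hF, rfl, rfl⟩
    exact ⟨fun h => hG.not_reachable_deleteEdges huv hF (SimpleGraph.ConnectedComponent.exact h),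
      Or.inl ⟨u, v, huv, hF, rfl, rfl⟩⟩

theorem edgeSet_contractGraph {V : Type} {G : SimpleGraph V} (hG : G.IsAcyclic)
    {F : Set (Sym2 V)} (hF : F ⊆ G.edgeSet) :
    (contractGraph G F).edgeSet = contractEdge G F '' F := by
  ext e
  induction e with | h c c' =>
  rw [SimpleGraph.mem_edgeSet, contractGraph_adj hG]
  constructor
  · rintro ⟨u, v, -, he, rfl, rfl⟩
    exact ⟨s(u, v), he, rfl⟩
  · rintro ⟨e, he, h⟩
    induction e with | h u v =>
    rw [contractEdge, Sym2.map_mk, Sym2.eq_iff] at h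
    obtain ⟨hu, hv⟩ | ⟨hu, hv⟩ := h
    · exact ⟨u, v, hF he, he, hu, hv⟩
    · exact ⟨v, u, (hF he).symm, Sym2.eq_swap ▸ he, hv, hu⟩

theorem reachable_contractGraph_deleteEdges_iff {V : Type} {G : SimpleGraph V}
    (hG : G.IsAcyclic) {F A : Set (Sym2 V)} (hF : F ⊆ G.edgeSet) (hA : A ⊆ F) (u v : V) :
    ((contractGraph G F).deleteEdges (contractEdge G F '' A)).Reachable
      ((G.deleteEdges F).connectedComponentMk u) ((G.deleteEdges F).connectedComponentMk v) ↔
    (G.deleteEdges A).Reachable u v := by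
  constructor
  · let f : ContVtx G F → (G.deleteEdges A).ConnectedComponent :=
      SimpleGraph.ConnectedComponent.map (.ofLE (SimpleGraph.deleteEdges_anti hA))
    suffices hf : ∀ c c', ((contractGraph G F).deleteEdges (contractEdge G F '' A)).Reachable c c' →
        f c = f c' from fun h => SimpleGraph.ConnectedComponent.exact (hf _ _ h)
    rintro c c' ⟨p⟩
    induction p with
    | nil => rfl
    | cons hadj _ ih =>
      rw [← ih]
      rw [SimpleGraph.deleteEdges_adj, contractGraph_adj hG] at hadj
      obtain ⟨⟨x, y, hxy, -, rfl, rfl⟩, hnot⟩ := hadj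
      refine SimpleGraph.ConnectedComponent.sound (SimpleGraph.Adj.reachable ?_)
      exact SimpleGraph.deleteEdges_adj.2 ⟨hxy, fun h => hnot ⟨_, h, rfl⟩⟩
  · rintro ⟨p⟩
    induction p with
    | nil => rfl
    | @cons x y _ hadj _ ih =>
      refine SimpleGraph.Reachable.trans ?_ ih
      rw [SimpleGraph.deleteEdges_adj] at hadj
      by_cases he : s(x, y) ∈ F
      · refine SimpleGraph.Adj.reachable (SimpleGraph.deleteEdges_adj.2
          ⟨(contractGraph_adj hG).2 ⟨x, y, hadj.1, he, rfl, rfl⟩, ?_⟩)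
        rintro ⟨e, heA, h⟩
        exact hadj.2 (contractEdge_injOn hG hF (hA heA) he h ▸ heA)
      · rw [SimpleGraph.ConnectedComponent.sound
          (SimpleGraph.deleteEdges_adj.2 ⟨hadj.1, he⟩ : (G.deleteEdges F).Adj x y).reachable]

theorem componentSizes_deleteEdges_eq_wComponentSizes {V : Type} [Fintype V]
    {G : SimpleGraph V} (hG : G.IsAcyclic) {F A : Set (Sym2 V)} (hF : F ⊆ G.edgeSet)
    (hA : A ⊆ F) :
    componentSizes (G.deleteEdges A) =
      wComponentSizes ((contractGraph G F).deleteEdges (contractEdge G F '' A))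
        (contractWeight G F) :=
  componentSizes_eq_wComponentSizes (q := (G.deleteEdges F).connectedComponentMk)
    Quot.mk_surjective
    (reachable_contractGraph_deleteEdges_iff hG hF hA) fun _ => rfl

theorem UFPoly_eq_WPoly_contractGraph {V : Type} [Fintype V] {G : SimpleGraph V}
    (hG : G.IsAcyclic) {F : Finset (Sym2 V)} (hF : (F : Set (Sym2 V)) ⊆ G.edgeSet) :
    UFPoly G F = WPoly (contractGraph G F) (contractWeight G F) := by
  have hinj := contractEdge_injOn hG hF
  have hedge : (contractGraph G F).edgeFinset = F.image (contractEdge G F) := by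
    rw [← Finset.coe_inj, SimpleGraph.coe_edgeFinset, edgeSet_contractGraph hG hF,
      Finset.coe_image]
  simp only [UFPoly, WPoly, hedge, Multiset.bind_def, Multiset.pure_def, Multiset.bind_singleton,
    Multiset.map_map]
  refine Multiset.map_eq_map_of_bij_of_nodup _ _ (Finset.nodup _) (Finset.nodup _)
    (fun A _ => A.image (contractEdge G F)) ?_ ?_ ?_ ?_
  · exact fun A hA => Finset.mem_powerset.2 (Finset.image_subset_image (Finset.mem_powerset.1 hA))
  · intro A hA B hB h
    rw [← Finset.coe_inj, Finset.coe_image, Finset.coe_image] at h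
    exact Finset.coe_inj.1 ((hinj.image_eq_image_iff
      (Finset.coe_subset.2 (Finset.mem_powerset.1 hA))
      (Finset.coe_subset.2 (Finset.mem_powerset.1 hB))).1 h)
  · intro B hB
    obtain ⟨A, hA, rfl⟩ := Finset.subset_image_iff.1 (Finset.mem_powerset.1 hB)
    exact ⟨A, Finset.mem_powerset.2 (Finset.coe_subset.1 hA), rfl⟩
  · intro A hA
    rw [Function.comp_apply, Function.comp_apply,
      componentSizes_deleteEdges_eq_wComponentSizes hG hF
        (Finset.coe_subset.2 (Finset.mem_powerset.1 hA)), Finset.coe_image]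
    congr!

/-- Let `T` be a tree and `S` a subtree with edge set `F`.  For every `A ⊆ F`, the
partition `λ_T(E∖A)` equals the weighted partition `λ_{S_{ω,T}}(F∖A)` of the
contraction `S_{ω,T}` of `S` in `T`; consequently `U_F(T) = W(S_{ω,T})`. -/
theorem contraction_lemma {V : Type} [Fintype V] (G : SimpleGraph V) (hG : G.IsTree)
    (S : G.Subgraph) (hS : S.Connected) :
    (∀ A : Finset (Sym2 V), ↑A ⊆ S.edgeSet →
      componentSizes (G.deleteEdges ↑A) =
        wComponentSizes
          ((contractGraph G S.edgeSet).deleteEdges (contractEdge G S.edgeSet '' ↑A))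
          (contractWeight G S.edgeSet)) ∧
    UFPoly G S.edgeSet.toFinset =
      WPoly (contractGraph G S.edgeSet) (contractWeight G S.edgeSet) := by
  refine ⟨fun A hA => componentSizes_deleteEdges_eq_wComponentSizes hG.isAcyclic
    S.edgeSet_subset hA, ?_⟩
  have h := UFPoly_eq_WPoly_contractGraph hG.isAcyclic (F := S.edgeSet.toFinset)
    (by rw [Set.coe_toFinset]; exact S.edgeSet_subset)
  rw [h]
  congr! <;> exact Set.coe_toFinset _
end

section
/- Let α be a positive integer and let p and p' be two α-compatible sequences of length n with p =_1 p' (i.e. Σ_i p_i = Σ_i p'_i). Set T = T_α(p) and T' = T_α(p'), and let K and K' denote the edge sets of the cores of T and T' respectively, and E, E' their full edge sets. Then U_K(T) = U_{K'}(T') and U_{E∖K}(T) = U_{E'∖K'}(T'). -/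
open scoped Classical

/-- `a =_k b` : the power sums of orders `1,…,k` of the two sequences agree. -/
def PTErel (k : ℕ) {n : ℕ} {R : Type*} [CommSemiring R] (a b : Fin n → R) : Prop :=
  ∀ ℓ : ℕ, 1 ≤ ℓ → ℓ ≤ k → ∑ i, (a i) ^ ℓ = ∑ i, (b i) ^ ℓ

/-- The edge set of the core of `T(p,s)`: the edges joining the central vertex to the
roots `v_1,…,v_n`. -/
noncomputable def coreEdges (n : ℕ) (p s : Fin n → ℕ) : Finset (Sym2 (Vtx n p s)) :=
  Finset.univ.image fun i : Fin n =>
    s((Sum.inl () : Vtx n p s), Sum.inr (Sum.inl i))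

theorem componentSizes_eq_of_equiv {V V' : Type} [Fintype V] [Fintype V'] {H : SimpleGraph V}
    {H' : SimpleGraph V'} (e : V ≃ V') (h : ∀ u v, H.Adj u v → H'.Reachable (e u) (e v))
    (h' : ∀ u v, H'.Adj u v → H.Reachable (e.symm u) (e.symm v)) :
    componentSizes H = componentSizes H' := by
  have reach {V V' : Type} {H : SimpleGraph V} {H' : SimpleGraph V'} (f : V → V')
      (h : ∀ u v, H.Adj u v → H'.Reachable (f u) (f v)) (u v : V) (huv : H.Reachable u v) :
      H'.Reachable (f u) (f v) := by
    obtain ⟨w⟩ := huv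
    induction w with
    | nil => exact .rfl
    | cons hadj _ ih => exact (h _ _ hadj).trans ih
  have hiff (u v : V) : H.Reachable u v ↔ H'.Reachable (e u) (e v) :=
    ⟨reach e h u v, fun hr => by simpa using reach e.symm h' _ _ hr⟩
  let c : H.ConnectedComponent ≃ H'.ConnectedComponent := Quot.congr e hiff
  have hcard (C : H.ConnectedComponent) : Nat.card C.supp = Nat.card (c C).supp := by
    refine Nat.card_congr (e.subtypeEquiv fun v => ?_)
    induction C using SimpleGraph.ConnectedComponent.ind with
    | _ u =>
      change _ ↔ H'.connectedComponentMk (e v) = H'.connectedComponentMk (e u)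
      rw [SimpleGraph.ConnectedComponent.mem_supp_iff, SimpleGraph.ConnectedComponent.eq,
        SimpleGraph.ConnectedComponent.eq, hiff]
  unfold componentSizes
  rw [← Finset.map_univ_equiv c, Finset.map_val, Multiset.map_map]
  exact Multiset.map_congr rfl fun C _ => hcard C

/-- A partial `U`-polynomial, with the edge set indexed by a finite type. -/
theorem UFPoly_eq_map_univ {V X : Type} [Fintype V] [Fintype X] (G : SimpleGraph V)
    {f : X → Sym2 V} (hf : Function.Injective f) {F : Finset (Sym2 V)}
    (hF : ∀ a, a ∈ F ↔ a ∈ Set.range f) :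
    UFPoly G F = (Finset.univ : Finset (Finset X)).val.map fun B : Finset X =>
      componentSizes (G.deleteEdges (f '' (B : Set X))) := by
  have hpow : F.powerset = Finset.univ.map (Finset.mapEmbedding ⟨f, hf⟩).toEmbedding := by
    have hF' : F = Finset.univ.map ⟨f, hf⟩ := by ext a; simp [hF]
    subst hF'
    ext A
    simp only [Finset.mem_powerset, Finset.mem_map, Finset.mem_univ, true_and,
      Finset.subset_map_iff, Finset.subset_univ]
    exact ⟨fun ⟨B, hB⟩ => ⟨B, hB.symm⟩, fun ⟨B, hB⟩ => ⟨B, hB.symm⟩⟩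
  rw [UFPoly, hpow, bind_pure_comp, Multiset.fmap_def, Finset.map_val, Multiset.map_map,
    Multiset.map_map]
  refine Multiset.map_congr rfl fun B _ => ?_
  simp

theorem UFPoly_eq_of_equiv {V V' X X' : Type} [Fintype V] [Fintype V'] [Fintype X] [Fintype X']
    {G : SimpleGraph V} {G' : SimpleGraph V'} {f : X → Sym2 V} {g : X' → Sym2 V'}
    (hf : Function.Injective f) (hg : Function.Injective g) {F : Finset (Sym2 V)}
    {F' : Finset (Sym2 V')} (hF : ∀ a, a ∈ F ↔ a ∈ Set.range f)
    (hF' : ∀ a, a ∈ F' ↔ a ∈ Set.range g) (e : X ≃ X')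
    (h : ∀ B : Set X, componentSizes (G.deleteEdges (f '' B)) =
      componentSizes (G'.deleteEdges (g '' (e '' B)))) :
    UFPoly G F = UFPoly G' F' := by
  rw [UFPoly_eq_map_univ G hf hF, UFPoly_eq_map_univ G' hg hF',
    ← Finset.map_univ_equiv e.finsetCongr, Finset.map_val, Multiset.map_map]
  refine Multiset.map_congr rfl fun B _ => ?_
  simp [h]

section Tree

variable {n : ℕ} {p s p' s' : Fin n → ℕ}

/-- The non-core vertices of `T(p,s)`. -/
abbrev OuterVtx (n : ℕ) (p s : Fin n → ℕ) : Type :=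
  (Σ i : Fin n, Fin (p i) × Fin 3) ⊕ (Σ i : Fin n, Fin (s i) × Fin 3)

/-- The central vertex of `T(p,s)`. -/
def centerVtx : Vtx n p s := Sum.inl ()

/-- The root `v_i` of `T(p,s)`. -/
def rootVtx (i : Fin n) : Vtx n p s := Sum.inr (Sum.inl i)

/-- The inclusion of the non-core vertices of `T(p,s)`. -/
def outerVtx (x : OuterVtx n p s) : Vtx n p s := Sum.inr (Sum.inr x)

/-- The neighbour of a non-core vertex on its way to the centre. -/
def parentVtx : OuterVtx n p s → Vtx n p s
  | Sum.inl ⟨i, _, 0⟩ => rootVtx i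
  | Sum.inl ⟨i, j, 1⟩ => outerVtx (Sum.inl ⟨i, j, 0⟩)
  | Sum.inl ⟨i, j, 2⟩ => outerVtx (Sum.inl ⟨i, j, 1⟩)
  | Sum.inr ⟨i, _, 0⟩ => rootVtx i
  | Sum.inr ⟨i, j, 1⟩ => outerVtx (Sum.inr ⟨i, j, 0⟩)
  | Sum.inr ⟨i, j, 2⟩ => outerVtx (Sum.inr ⟨i, j, 0⟩)

/-- The index of the copy of `B(p_i,s_i)` containing a non-core vertex. -/
def branch : OuterVtx n p s → Fin n
  | Sum.inl x => x.1
  | Sum.inr x => x.1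

/-- The position of a non-core vertex in its copy of the path or star. -/
def position : OuterVtx n p s → ℕ
  | Sum.inl x => x.2.2
  | Sum.inr x => x.2.2

/-- The core edge at `v_i`. -/
def coreEdge (i : Fin n) : Sym2 (Vtx n p s) := s(centerVtx, rootVtx i)

/-- The edge joining a non-core vertex to its parent. -/
def outerEdge (x : OuterVtx n p s) : Sym2 (Vtx n p s) := s(parentVtx x, outerVtx x)

theorem parentVtx_cases (x : OuterVtx n p s) :
    parentVtx x = rootVtx (branch x) ∨
      ∃ y, parentVtx x = outerVtx y ∧ branch y = branch x ∧ position y < position x := by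
  rcases x with ⟨i, j, k⟩ | ⟨i, j, k⟩ <;> fin_cases k <;>
    first
    | exact Or.inl rfl
    | exact Or.inr ⟨_, rfl, rfl, by simp [position]⟩

theorem parentVtx_ne_centerVtx (x : OuterVtx n p s) : parentVtx x ≠ centerVtx := by
  rcases parentVtx_cases x with h | ⟨y, h, -⟩ <;> simp [h, centerVtx, rootVtx, outerVtx]

theorem TRel_iff (u v : Vtx n p s) :
    TRel n p s u v ↔ (∃ i, u = centerVtx ∧ v = rootVtx i) ∨
      ∃ x, u = parentVtx x ∧ v = outerVtx x := by
  constructor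
  · rintro (i | ⟨i, j⟩ | ⟨i, j, l⟩ | ⟨i, j⟩ | ⟨i, j, l⟩)
    · exact Or.inl ⟨i, rfl, rfl⟩
    · exact Or.inr ⟨Sum.inl ⟨i, j, 0⟩, rfl, rfl⟩
    · exact Or.inr ⟨Sum.inl ⟨i, j, l.succ⟩, by fin_cases l <;> rfl, rfl⟩
    · exact Or.inr ⟨Sum.inr ⟨i, j, 0⟩, rfl, rfl⟩
    · exact Or.inr ⟨Sum.inr ⟨i, j, l.succ⟩, by fin_cases l <;> rfl, rfl⟩
  · rintro (⟨i, rfl, rfl⟩ | ⟨x, rfl, rfl⟩)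
    · exact .core i
    · rcases x with ⟨i, j, k⟩ | ⟨i, j, k⟩ <;> fin_cases k
      · exact .pathRoot i j
      · exact .pathEdge i j 0
      · exact .pathEdge i j 1
      · exact .starRoot i j
      · exact .starEdge i j 0
      · exact .starEdge i j 1

theorem coreEdge_injective : Function.Injective (coreEdge : Fin n → Sym2 (Vtx n p s)) := by
  intro i j h
  simpa [coreEdge, centerVtx, rootVtx] using h

theorem outerVtx_injective : Function.Injective (outerVtx : OuterVtx n p s → Vtx n p s) :=
  Sum.inr_injective.comp Sum.inr_injective

theorem parentVtx_eq_outerVtx {x y : OuterVtx n p s} (h : parentVtx x = outerVtx y) :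
    position y < position x := by
  rcases parentVtx_cases x with h' | ⟨z, h', -, hz⟩
  · simp [h', rootVtx, outerVtx] at h
  · rwa [← outerVtx_injective (h'.symm.trans h)]

theorem outerEdge_injective :
    Function.Injective (outerEdge : OuterVtx n p s → Sym2 (Vtx n p s)) := by
  intro x y h
  rcases Sym2.eq_iff.1 h with ⟨-, h⟩ | ⟨h, h'⟩
  · exact outerVtx_injective h
  · exact absurd (parentVtx_eq_outerVtx h) (parentVtx_eq_outerVtx h'.symm).not_gt

theorem coreEdge_ne_outerEdge (i : Fin n) (x : OuterVtx n p s) : coreEdge i ≠ outerEdge x := by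
  intro h
  rcases Sym2.eq_iff.1 h with ⟨h, -⟩ | ⟨h, -⟩
  · exact parentVtx_ne_centerVtx x h.symm
  · simp [centerVtx, outerVtx] at h

theorem mem_edgeSet_TpsGraph (a : Sym2 (Vtx n p s)) :
    a ∈ (TpsGraph n p s).edgeSet ↔ a ∈ Set.range coreEdge ∨ a ∈ Set.range outerEdge := by
  have hadj (u v : Vtx n p s) : (TpsGraph n p s).Adj u v ↔ TRel n p s u v ∨ TRel n p s v u := by
    refine ⟨fun h => h.2, fun h => ⟨?_, h⟩⟩
    rintro rfl
    rcases (TRel_iff u u).1 (by simpa using h) with ⟨i, h, h'⟩ | ⟨x, h, h'⟩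
    · simp [h', centerVtx, rootVtx] at h
    · exact (parentVtx_eq_outerVtx (h.symm.trans h')).false
  induction a with
  | _ u v =>
    rw [SimpleGraph.mem_edgeSet, hadj, TRel_iff, TRel_iff]
    simp only [Set.mem_range, coreEdge, outerEdge, Sym2.eq_iff]
    grind

theorem mem_coreEdges (a : Sym2 (Vtx n p s)) :
    a ∈ coreEdges n p s ↔ a ∈ Set.range coreEdge := by
  simp [coreEdges, coreEdge, centerVtx, rootVtx]

theorem mem_edgeFinset_sdiff_coreEdges (a : Sym2 (Vtx n p s)) :
    a ∈ (TpsGraph n p s).edgeFinset \ coreEdges n p s ↔ a ∈ Set.range outerEdge := by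
  rw [Finset.mem_sdiff, SimpleGraph.mem_edgeFinset, mem_edgeSet_TpsGraph, mem_coreEdges]
  constructor
  · tauto
  · rintro ⟨x, rfl⟩
    exact ⟨Or.inr ⟨x, rfl⟩, fun ⟨i, hi⟩ => coreEdge_ne_outerEdge i x hi⟩

theorem deleteEdges_adj_root {D : Set (Sym2 (Vtx n p s))} {i : Fin n} (h : coreEdge i ∉ D) :
    ((TpsGraph n p s).deleteEdges D).Adj centerVtx (rootVtx i) :=
  SimpleGraph.deleteEdges_adj.2 ⟨(mem_edgeSet_TpsGraph (coreEdge i)).2 (Or.inl ⟨i, rfl⟩), h⟩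

theorem deleteEdges_adj_outer {D : Set (Sym2 (Vtx n p s))} {x : OuterVtx n p s}
    (h : outerEdge x ∉ D) :
    ((TpsGraph n p s).deleteEdges D).Adj (parentVtx x) (outerVtx x) :=
  SimpleGraph.deleteEdges_adj.2 ⟨(mem_edgeSet_TpsGraph (outerEdge x)).2 (Or.inr ⟨x, rfl⟩), h⟩

/-- To map the edges of `T(p,s) ∖ D` into the components of a graph it suffices to treat
the surviving core edges and the surviving non-core edges. -/
theorem reachable_of_deleteEdges_adj {D : Set (Sym2 (Vtx n p s))} {V : Type} {H : SimpleGraph V}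
    {φ : Vtx n p s → V}
    (hcore : ∀ i, coreEdge i ∉ D → H.Reachable (φ centerVtx) (φ (rootVtx i)))
    (houter : ∀ x, outerEdge x ∉ D → H.Reachable (φ (parentVtx x)) (φ (outerVtx x)))
    (u v : Vtx n p s) (h : ((TpsGraph n p s).deleteEdges D).Adj u v) :
    H.Reachable (φ u) (φ v) := by
  obtain ⟨h, hD⟩ := SimpleGraph.deleteEdges_adj.1 h
  have rel {u v : Vtx n p s} (h : TRel n p s u v) (hD : s(u, v) ∉ D) :
      H.Reachable (φ u) (φ v) := by
    rcases (TRel_iff u v).1 h with ⟨i, rfl, rfl⟩ | ⟨x, rfl, rfl⟩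
    · exact hcore i hD
    · exact houter x hD
  rcases h.2 with h | h
  · exact rel h hD
  · exact (rel h (by rwa [Sym2.eq_swap])).symm

/-- The bijection of vertices that fixes the core and acts on the other vertices as given. -/
def vtxEquiv (θ : OuterVtx n p s ≃ OuterVtx n p' s') : Vtx n p s ≃ Vtx n p' s' :=
  Equiv.sumCongr (Equiv.refl _) (Equiv.sumCongr (Equiv.refl _) θ)

theorem reachable_root_of_coreEdges (B : Set (Fin n)) (x : OuterVtx n p s) :
    ((TpsGraph n p s).deleteEdges (coreEdge '' B)).Reachable (rootVtx (branch x))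
      (outerVtx x) := by
  induction hk : position x using Nat.strong_induction_on generalizing x with
  | _ k ih =>
    have hadj := (deleteEdges_adj_outer (D := coreEdge '' B) (x := x)
      fun ⟨i, _, hi⟩ => coreEdge_ne_outerEdge i x hi).reachable
    rcases parentVtx_cases x with h | ⟨y, h, hy, hlt⟩
    · rwa [h] at hadj
    · rw [h] at hadj
      exact hy ▸ (ih _ (hk ▸ hlt) y rfl).trans hadj

theorem reachable_vtxEquiv_of_coreEdges {θ : OuterVtx n p s ≃ OuterVtx n p' s'}
    (hθ : ∀ x, branch (θ x) = branch x) (B : Set (Fin n)) (u v : Vtx n p s)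
    (h : ((TpsGraph n p s).deleteEdges (coreEdge '' B)).Adj u v) :
    ((TpsGraph n p' s').deleteEdges (coreEdge '' B)).Reachable (vtxEquiv θ u)
      (vtxEquiv θ v) := by
  refine reachable_of_deleteEdges_adj (φ := vtxEquiv θ) (fun i hi => ?_) (fun x _ => ?_) u v h
  · refine (deleteEdges_adj_root ?_).reachable
    rw [coreEdge_injective.mem_set_image] at hi ⊢
    exact hi
  · have hx := reachable_root_of_coreEdges B (θ x)
    rw [hθ] at hx
    rcases parentVtx_cases x with h | ⟨y, h, hy, -⟩
    · rw [h]
      exact hx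
    · have hy' := reachable_root_of_coreEdges B (θ y)
      rw [hθ, hy] at hy'
      rw [h]
      exact hy'.symm.trans hx

/-- Deleting core edges, only the sizes `p_i + s_i` of the branches matter. -/
theorem UFPoly_coreEdges_eq (h : ∀ i, p i + s i = p' i + s' i) :
    UFPoly (TpsGraph n p s) (coreEdges n p s) =
      UFPoly (TpsGraph n p' s') (coreEdges n p' s') := by
  have e (i : Fin n) : Nonempty (Fin (p i) × Fin 3 ⊕ Fin (s i) × Fin 3 ≃
      Fin (p' i) × Fin 3 ⊕ Fin (s' i) × Fin 3) := by
    rw [← Fintype.card_eq]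
    simp only [Fintype.card_sum, Fintype.card_prod, Fintype.card_fin]
    linarith [h i]
  let θ : OuterVtx n p s ≃ OuterVtx n p' s' := (Equiv.sigmaSumDistrib _ _).symm.trans <|
    (Equiv.sigmaCongrRight fun i => (e i).some).trans (Equiv.sigmaSumDistrib _ _)
  have hbranch {p s : Fin n → ℕ} (z : Σ i, Fin (p i) × Fin 3 ⊕ Fin (s i) × Fin 3) :
      branch (Equiv.sigmaSumDistrib _ _ z) = z.1 := by
    rcases z with ⟨i, z | z⟩ <;> rfl
  have hθ (x) : branch (θ x) = branch x := by
    obtain ⟨z, rfl⟩ := (Equiv.sigmaSumDistrib _ _).surjective x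
    change branch (Equiv.sigmaSumDistrib _ _ (Equiv.sigmaCongrRight _
      ((Equiv.sigmaSumDistrib _ _).symm (Equiv.sigmaSumDistrib _ _ z)))) = _
    rw [Equiv.symm_apply_apply, hbranch, hbranch]
    rfl
  refine UFPoly_eq_of_equiv coreEdge_injective coreEdge_injective mem_coreEdges mem_coreEdges
    (Equiv.refl _) fun B => ?_
  rw [Equiv.coe_refl, Set.image_id]
  exact componentSizes_eq_of_equiv (vtxEquiv θ) (reachable_vtxEquiv_of_coreEdges hθ B)
    (reachable_vtxEquiv_of_coreEdges (θ := θ.symm) (fun x => by simpa using (hθ (θ.symm x)).symm) B)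

theorem reachable_roots_of_outerEdges (B : Set (OuterVtx n p s)) (i : Fin n) :
    ((TpsGraph n p s).deleteEdges (outerEdge '' B)).Reachable centerVtx (rootVtx i) :=
  (deleteEdges_adj_root (D := outerEdge '' B)
    fun ⟨x, _, hx⟩ => coreEdge_ne_outerEdge i x hx.symm).reachable

/-- The bijection of non-core vertices induced by bijections of the path and star copies. -/
def outerEquiv (σ : (Σ i, Fin (p i)) ≃ Σ i, Fin (p' i)) (τ : (Σ i, Fin (s i)) ≃ Σ i, Fin (s' i)) :
    OuterVtx n p s ≃ OuterVtx n p' s' :=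
  Equiv.sumCongr
    (((Equiv.sigmaProdDistrib _ _).symm.trans (σ.prodCongr (Equiv.refl _))).trans
      (Equiv.sigmaProdDistrib _ _))
    (((Equiv.sigmaProdDistrib _ _).symm.trans (τ.prodCongr (Equiv.refl _))).trans
      (Equiv.sigmaProdDistrib _ _))

theorem outerEquiv_parentVtx (σ : (Σ i, Fin (p i)) ≃ Σ i, Fin (p' i))
    (τ : (Σ i, Fin (s i)) ≃ Σ i, Fin (s' i)) (x : OuterVtx n p s) :
    vtxEquiv (outerEquiv σ τ) (parentVtx x) = parentVtx (outerEquiv σ τ x) ∨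
      ∃ i j, vtxEquiv (outerEquiv σ τ) (parentVtx x) = rootVtx i ∧
        parentVtx (outerEquiv σ τ x) = rootVtx j := by
  rcases x with ⟨i, j, k⟩ | ⟨i, j, k⟩ <;> fin_cases k <;>
    first
    | exact Or.inl rfl
    | exact Or.inr ⟨_, _, rfl, rfl⟩

theorem reachable_vtxEquiv_of_outerEdges (σ : (Σ i, Fin (p i)) ≃ Σ i, Fin (p' i))
    (τ : (Σ i, Fin (s i)) ≃ Σ i, Fin (s' i)) {B : Set (OuterVtx n p s)}
    {B' : Set (OuterVtx n p' s')} (hB : ∀ x, outerEquiv σ τ x ∈ B' → x ∈ B) (u v : Vtx n p s)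
    (h : ((TpsGraph n p s).deleteEdges (outerEdge '' B)).Adj u v) :
    ((TpsGraph n p' s').deleteEdges (outerEdge '' B')).Reachable
      (vtxEquiv (outerEquiv σ τ) u) (vtxEquiv (outerEquiv σ τ) v) := by
  refine reachable_of_deleteEdges_adj (φ := vtxEquiv (outerEquiv σ τ))
    (fun i _ => reachable_roots_of_outerEdges B' i) (fun x hx => ?_) u v h
  have hx' : outerEdge (outerEquiv σ τ x) ∉ outerEdge '' B' := by
    rw [outerEdge_injective.mem_set_image] at hx ⊢
    exact fun h => hx (hB x h)
  refine .trans ?_ (deleteEdges_adj_outer hx').reachable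
  rcases outerEquiv_parentVtx σ τ x with h | ⟨i, j, h, h'⟩
  · rw [h]
  · rw [h, h']
    exact (reachable_roots_of_outerEdges B' i).symm.trans (reachable_roots_of_outerEdges B' j)

/-- Deleting non-core edges, only the total numbers of path and star copies matter. -/
theorem UFPoly_edgeFinset_sdiff_coreEdges_eq (hp : ∑ i, p i = ∑ i, p' i)
    (hs : ∑ i, s i = ∑ i, s' i) :
    UFPoly (TpsGraph n p s) ((TpsGraph n p s).edgeFinset \ coreEdges n p s) =
      UFPoly (TpsGraph n p' s') ((TpsGraph n p' s').edgeFinset \ coreEdges n p' s') := by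
  have σ : (Σ i, Fin (p i)) ≃ Σ i, Fin (p' i) := Fintype.equivOfCardEq (by simpa using hp)
  have τ : (Σ i, Fin (s i)) ≃ Σ i, Fin (s' i) := Fintype.equivOfCardEq (by simpa using hs)
  refine UFPoly_eq_of_equiv outerEdge_injective outerEdge_injective
    mem_edgeFinset_sdiff_coreEdges mem_edgeFinset_sdiff_coreEdges (outerEquiv σ τ) fun B => ?_
  refine componentSizes_eq_of_equiv (vtxEquiv (outerEquiv σ τ))
    (reachable_vtxEquiv_of_outerEdges σ τ fun x => by simp)
    (reachable_vtxEquiv_of_outerEdges σ.symm τ.symm fun x hx => ?_)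
  exact ⟨_, hx, (outerEquiv σ τ).apply_symm_apply x⟩

end Tree

/-- If `p =_1 p'` are `α`-compatible sequences and `K`, `K'` are the edge sets of the
cores of `T = T_α(p)` and `T' = T_α(p')`, then `U_K(T) = U_{K'}(T')` and
`U_{E∖K}(T) = U_{E'∖K'}(T')`. -/
theorem core_UF_polynomials_agree (α n : ℕ) (hα : 0 < α)
    (p p' : Fin n → ℕ) (hp : AlphaCompatible α p) (hp' : AlphaCompatible α p')
    (h1 : PTErel 1 p p') :
    UFPoly (Ttree α p) (coreEdges n p (fun i => α - p i)) =
      UFPoly (Ttree α p') (coreEdges n p' (fun i => α - p' i)) ∧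
    UFPoly (Ttree α p)
        ((Ttree α p).edgeFinset \ coreEdges n p (fun i => α - p i)) =
      UFPoly (Ttree α p')
        ((Ttree α p').edgeFinset \ coreEdges n p' (fun i => α - p' i)) := by
  have hsum : ∑ i, p i = ∑ i, p' i := by simpa using h1 1 le_rfl le_rfl
  refine ⟨UFPoly_coreEdges_eq fun i => ?_, UFPoly_edgeFinset_sdiff_coreEdges_eq hsum ?_⟩
  · have := hp.2 i
    have := hp'.2 i
    lia
  · rw [Finset.sum_tsub_distrib _ fun i _ => hp.2 i, Finset.sum_tsub_distrib _ fun i _ => hp'.2 i,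
      hsum]
end
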